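/- Let (W,S) and (W,S') be Coxeter systems on the same group W such that m(s,t) is even for all distinct s,t ∈ S and m'(s',t') is even for all distinct s',t' ∈ S' (both systems are even; infinite orders allowed). Then (W,S) and (W,S') are isomorphic, i.e., there is a bijection ψ: S → S' with m(s,t) = m'(ψ(s),ψ(t)) for all s,t ∈ S. -/

import Mathlib

set_option linter.all false


namespace EvenCox

section Geo

variable {B : Type*} [Fintype B] [DecidableEq B] (M : CoxeterMatrix B)

noncomputable def bf : LinearMap.BilinForm ℝ (B → ℝ) :=
  Matrix.toBilin' (Matrix.of fun i j => -Real.cos (Real.pi / M i j))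

noncomputable abbrev al (i : B) : B → ℝ := Pi.single i 1

lemma bf_al (i j : B) : bf M (al i) (al j) = -Real.cos (Real.pi / M i j) := by
  simp [bf, Matrix.toBilin'_single]

lemma bf_self (i : B) : bf M (al i) (al i) = 1 := by
  simp [bf_al]

lemma vec_eq (v : B → ℝ) : v = ∑ i, v i • al i := by
  ext j
  simp [Finset.sum_apply, Pi.single_apply]

lemma bf_left (v w : B → ℝ) : bf M v w = ∑ i, v i * bf M (al i) w := by
  conv_lhs => rw [vec_eq v]
  simp [map_sum, LinearMap.sum_apply]

lemma bf_right (v w : B → ℝ) : bf M v w = ∑ i, w i * bf M v (al i) := by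
  conv_lhs => rw [vec_eq w]
  simp [map_sum]

lemma bf_symm (v w : B → ℝ) : bf M v w = bf M w v := by
  rw [bf_left, bf_right]
  refine Finset.sum_congr rfl fun i _ => ?_
  congr 1
  rw [bf_right M (al i) w, bf_left M w (al i)]
  refine Finset.sum_congr rfl fun j _ => ?_
  rw [bf_al, bf_al, M.symmetric]

noncomputable def sg (i : B) : Module.End ℝ (B → ℝ) :=
  LinearMap.id - (2 : ℝ) • (bf M (al i)).smulRight (al i)

lemma sg_apply (i : B) (v : B → ℝ) : sg M i v = v - (2 * bf M (al i) v) • al i := by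
  simp [sg, smul_smul]

lemma sg_sg (i : B) (v : B → ℝ) : sg M i (sg M i v) = v := by
  simp only [sg_apply, map_sub, map_smul, bf_self, smul_eq_mul]
  ext k
  simp only [Pi.sub_apply, Pi.smul_apply, smul_eq_mul]
  ring

lemma bf_sg (i : B) (v w : B → ℝ) : bf M (sg M i v) (sg M i w) = bf M v w := by
  simp only [sg_apply, map_sub, map_smul, LinearMap.sub_apply, LinearMap.smul_apply, bf_self,
    smul_eq_mul, bf_symm M v (al i)]
  ring

noncomputable def cS (c : ℝ) : ℕ → ℝ
  | 0 => 0
  | 1 => 1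
  | n + 2 => 2 * c * cS c (n + 1) - cS c n

lemma sin_cS (θ : ℝ) (n : ℕ) : Real.sin θ * cS (Real.cos θ) n = Real.sin (n * θ) := by
  induction n using Nat.twoStepInduction with
  | zero => simp [cS]
  | one => simp [cS]
  | more n h1 h2 =>
    rw [cS, mul_sub, h1]
    have : Real.sin θ * (2 * Real.cos θ * cS (Real.cos θ) (n + 1)) =
      2 * Real.cos θ * Real.sin ((n + 1 : ℕ) * θ) := by rw [← h2]; ring
    rw [this]
    have e1 : ((n + 2 : ℕ) : ℝ) * θ = (n + 1 : ℕ) * θ + θ := by push_cast; ring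
    have e2 : ((n : ℕ) : ℝ) * θ = (n + 1 : ℕ) * θ - θ := by push_cast; ring
    rw [e1, e2, Real.sin_add, Real.sin_sub]; ring

lemma cS_one (n : ℕ) : cS 1 n = n := by
  induction n using Nat.twoStepInduction with
  | zero => simp [cS]
  | one => simp [cS]
  | more n h1 h2 => rw [cS, h1, h2]; push_cast; ring

lemma cS_nonneg (m n : ℕ) (hm : m ≠ 1) (h : m = 0 ∨ n ≤ m) : 0 ≤ cS (Real.cos (Real.pi / m)) n := by
  rcases Nat.eq_zero_or_pos m with h0 | hp
  · subst h0; simp [cS_one]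
  have hn : n ≤ m := by omega
  have hm2 : (2 : ℝ) ≤ m := by exact_mod_cast (by omega : 2 ≤ m)
  have hpi := Real.pi_pos
  have hs : 0 < Real.sin (Real.pi / m) := by
    apply Real.sin_pos_of_pos_of_lt_pi
    · positivity
    · exact div_lt_self hpi (by linarith)
  have h2 := sin_cS (Real.pi / m) n
  have h3 : 0 ≤ Real.sin (n * (Real.pi / m)) := by
    apply Real.sin_nonneg_of_nonneg_of_le_pi
    · positivity
    · have : (n : ℝ) ≤ m := by exact_mod_cast hn
      rw [mul_div_assoc', div_le_iff₀ (by linarith)]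
      nlinarith
  by_contra hneg
  push Not at hneg
  nlinarith

lemma sg_pow (i j : B) (n : ℕ) :
    ((sg M i * sg M j) ^ n) (al i) =
      cS (Real.cos (Real.pi / M i j)) (2 * n + 1) • al i +
      cS (Real.cos (Real.pi / M i j)) (2 * n) • al j := by
  induction n with
  | zero => simp [cS]
  | succ n ih =>
    rw [pow_succ', Module.End.mul_apply, ih, Module.End.mul_apply]
    simp only [sg_apply, map_add, map_sub, map_smul, bf_al, M.symmetric j i, M.diagonal,
      smul_eq_mul]
    rw [show 2 * (n + 1) + 1 = (2 * n + 1) + 2 by ring, show 2 * (n + 1) = 2 * n + 2 by ring,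
      cS, show 2 * n + 1 + 1 = 2 * n + 2 by ring, cS]
    simp only [Nat.cast_one, div_one, Real.cos_pi]
    ext k
    simp only [Pi.add_apply, Pi.sub_apply, Pi.smul_apply, smul_eq_mul]
    ring

lemma sg_pow_odd (i j : B) (n : ℕ) :
    sg M j (((sg M i * sg M j) ^ n) (al i)) =
      cS (Real.cos (Real.pi / M i j)) (2 * n + 1) • al i +
      cS (Real.cos (Real.pi / M i j)) (2 * n + 2) • al j := by
  rw [sg_pow]
  simp only [sg_apply, map_add, map_smul, bf_al, M.symmetric j i, M.diagonal, smul_eq_mul]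
  rw [cS]
  simp only [Nat.cast_one, div_one, Real.cos_pi]
  ext k
  simp only [Pi.add_apply, Pi.sub_apply, Pi.smul_apply, smul_eq_mul]
  ring

lemma sg_pow_al (i j : B) (hij : i ≠ j) : ((sg M i * sg M j) ^ (M i j)) (al i) = al i := by
  by_cases h0 : M i j = 0
  · simp [h0]
  rw [sg_pow]
  have h1 := M.off_diagonal i j hij
  set m := M i j
  have hm2 : (2 : ℝ) ≤ m := by exact_mod_cast (by omega : 2 ≤ m)
  have hpi := Real.pi_pos
  have hs : 0 < Real.sin (Real.pi / m) := by
    apply Real.sin_pos_of_pos_of_lt_pi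
    · positivity
    · exact div_lt_self hpi (by linarith)
  have e1 := sin_cS (Real.pi / m) (2 * m)
  have e2 := sin_cS (Real.pi / m) (2 * m + 1)
  have f1 : ((2 * m : ℕ) : ℝ) * (Real.pi / m) = 2 * Real.pi := by push_cast; field_simp
  have f2 : ((2 * m + 1 : ℕ) : ℝ) * (Real.pi / m) = Real.pi / m + 2 * Real.pi := by
    push_cast; field_simp; ring
  rw [f1, Real.sin_two_pi] at e1
  rw [f2, Real.sin_add_two_pi] at e2
  have g1 : cS (Real.cos (Real.pi / m)) (2 * m) = 0 := by
    rcases mul_eq_zero.1 e1 with h | h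
    · exact absurd h hs.ne'
    · exact h
  have g2 : cS (Real.cos (Real.pi / m)) (2 * m + 1) = 1 := by
    apply mul_left_cancel₀ hs.ne'; rw [e2, mul_one]
  rw [g1, g2]; simp

lemma sg_mul_inv (i j : B) (n : ℕ) (v : B → ℝ) :
    ((sg M i * sg M j) ^ n) (((sg M j * sg M i) ^ n) v) = v := by
  induction n generalizing v with
  | zero => simp
  | succ n ih =>
    rw [pow_succ, pow_succ' (sg M j * sg M i), Module.End.mul_apply, Module.End.mul_apply]
    simp only [Module.End.mul_apply, sg_sg]
    exact ih v

lemma sg_liftable : M.IsLiftable (sg M) := by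
  intro i j
  by_cases hij : i = j
  · subst hij
    rw [M.diagonal, pow_one]
    exact LinearMap.ext fun v => by simp [sg_sg]
  by_cases h0 : M i j = 0
  · simp [h0]
  have h1 := M.off_diagonal i j hij
  have a1 := sg_pow_al M i j hij
  have a2 : ((sg M i * sg M j) ^ (M i j)) (al j) = al j := by
    have := sg_pow_al M j i (Ne.symm hij)
    rw [M.symmetric j i] at this
    conv_lhs => rw [← this]
    exact sg_mul_inv M i j _ _
  set m := M i j with hm
  have hm2 : (2 : ℝ) ≤ m := by exact_mod_cast (by omega : 2 ≤ m)
  have hpi := Real.pi_pos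
  have hs : 0 < Real.sin (Real.pi / m) := by
    apply Real.sin_pos_of_pos_of_lt_pi
    · positivity
    · exact div_lt_self hpi (by linarith)
  refine LinearMap.ext fun v => ?_
  set c := Real.cos (Real.pi / m)
  set s := Real.sin (Real.pi / m)
  have hcs : s ^ 2 + c ^ 2 = 1 := Real.sin_sq_add_cos_sq _
  set p := bf M (al i) v
  set q := bf M (al j) v
  -- decomposition
  set a := (p + c * q) / s ^ 2
  set b := (q + c * p) / s ^ 2
  have hs2 : s ^ 2 ≠ 0 := by positivity
  set v0 := v - a • al i - b • al j with hv0
  have k1 : bf M (al i) v0 = 0 := by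
    simp only [hv0, map_sub, map_smul, bf_self, bf_al, smul_eq_mul, ← hm]
    change p - a * 1 - b * -c = 0
    simp only [a, b]; field_simp; linear_combination (p) * hcs
  have k2 : bf M (al j) v0 = 0 := by
    simp only [hv0, map_sub, map_smul, bf_self, bf_al, smul_eq_mul, M.symmetric j i, ← hm]
    change q - a * -c - b * 1 = 0
    simp only [a, b]; field_simp; linear_combination (q) * hcs
  have k3 : ∀ n, ((sg M i * sg M j) ^ n) v0 = v0 := by
    intro n
    induction n with
    | zero => simp
    | succ n ih =>
      rw [pow_succ', Module.End.mul_apply, ih, Module.End.mul_apply, sg_apply M j, k2]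
      simp [sg_apply, k1]
  have : v = v0 + a • al i + b • al j := by rw [hv0]; abel
  rw [this, map_add, map_add, map_smul, map_smul, a1, a2, k3]
  simp

end Geo

end EvenCox



namespace EvenCox

section Root

variable {B W : Type*} [Fintype B] [DecidableEq B] [Group W] {M : CoxeterMatrix B}
  (cs : CoxeterSystem M W)

noncomputable def rep : W →* Module.End ℝ (B → ℝ) := cs.lift ⟨sg M, sg_liftable M⟩

lemma rep_simple (i : B) : rep cs (cs.simple i) = sg M i := cs.lift_apply_simple (sg_liftable M) i

lemma rep_mul (g h : W) (v : B → ℝ) : rep cs (g * h) v = rep cs g (rep cs h v) := by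
  rw [map_mul, Module.End.mul_apply]

lemma rep_inv (g : W) (v : B → ℝ) : rep cs g⁻¹ (rep cs g v) = v := by
  rw [← rep_mul]; simp

lemma rep_inv' (g : W) (v : B → ℝ) : rep cs g (rep cs g⁻¹ v) = v := by
  rw [← rep_mul]; simp

lemma bf_rep (g : W) : ∀ v w : B → ℝ, bf M (rep cs g v) (rep cs g w) = bf M v w := by
  induction g using cs.simple_induction with
  | simple i => intro v w; rw [rep_simple, bf_sg]
  | one => intro v w; simp
  | mul g h hg hh => intro v w; rw [rep_mul, rep_mul, hg, hh]

lemma alt_suffix (s t : B) (m n : ℕ) (h : m ≤ n) : ∃ y : W,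
    cs.length y ≤ n - m ∧ cs.wordProd (CoxeterSystem.alternatingWord s t n) =
      y * cs.wordProd (CoxeterSystem.alternatingWord s t m) := by
  induction n, h using Nat.le_induction with
  | base => exact ⟨1, by simp, by simp⟩
  | succ n hn ih =>
    obtain ⟨y, h1, h2⟩ := ih
    refine ⟨cs.simple (if Even n then t else s) * y, ?_, ?_⟩
    · have := cs.length_mul_le (cs.simple (if Even n then t else s)) y
      rw [cs.length_simple] at this
      omega
    · rw [CoxeterSystem.alternatingWord_succ', cs.wordProd_cons, h2, mul_assoc]

lemma length_alt_le (s t : B) (n : ℕ) :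
    cs.length (cs.wordProd (CoxeterSystem.alternatingWord s t n)) ≤ n := by
  have := cs.length_wordProd_le (CoxeterSystem.alternatingWord s t n)
  simpa using this

lemma rep_alt (s t : B) (n : ℕ) : ∃ a b : ℕ, a ≤ n + 1 ∧ b ≤ n + 1 ∧
    rep cs (cs.wordProd (CoxeterSystem.alternatingWord s t n)) (al s) =
    cS (Real.cos (Real.pi / M s t)) a • al s + cS (Real.cos (Real.pi / M s t)) b • al t := by
  rw [cs.prod_alternatingWord_eq_mul_pow, rep_mul, map_pow, map_mul, rep_simple, rep_simple]
  split_ifs with h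
  · refine ⟨2 * (n / 2) + 1, 2 * (n / 2), ?_, ?_, ?_⟩
    rotate_left 2
    · rw [map_one, Module.End.one_apply]; exact sg_pow M s t (n / 2)
    · omega
    · omega
  · refine ⟨2 * (n / 2) + 1, 2 * (n / 2) + 2, ?_, ?_, ?_⟩
    rotate_left 2
    · rw [rep_simple]; exact sg_pow_odd M s t (n / 2)
    · omega
    · have : n % 2 = 1 := by rw [← Nat.odd_iff]; exact Nat.not_even_iff_odd.1 h
      omega

lemma pos_aux (N : ℕ) : ∀ (w : W) (s : B), cs.length w = N →
    cs.length w < cs.length (w * cs.simple s) → 0 ≤ rep cs w (al s) := by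
  induction N using Nat.strong_induction_on with
  | _ N ih =>
  intro w s hN hw
  by_cases h1 : w = 1
  · subst h1
    simp only [map_one, Module.End.one_apply]
    exact Pi.single_nonneg.2 zero_le_one
  obtain ⟨t, ht⟩ := cs.exists_rightDescent_of_ne_one h1
  have ht : cs.length (w * cs.simple t) < cs.length w := ht
  have hst : s ≠ t := by rintro rfl; omega
  let P : ℕ → Prop := fun n => ∃ v : W,
    w = v * cs.wordProd (CoxeterSystem.alternatingWord s t n) ∧ cs.length w = cs.length v + n
  classical
  have hP0 : P 0 := ⟨w, by simp [CoxeterSystem.alternatingWord], by simp⟩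
  have hb : ∀ n, P n → n ≤ cs.length w := by rintro n ⟨v, -, h⟩; omega
  have hPn : P (Nat.findGreatest P (cs.length w)) := Nat.findGreatest_spec (Nat.zero_le _) hP0
  have hmax : ¬ P (Nat.findGreatest P (cs.length w) + 1) := fun h => by
    have := Nat.le_findGreatest (hb _ h) h
    omega
  generalize Nat.findGreatest P (cs.length w) = n at hPn hmax
  obtain ⟨v, hv, hl⟩ := hPn
  have nxt : cs.length v < cs.length (v * cs.simple (if Even n then t else s)) := by
    rcases cs.length_mul_simple v (if Even n then t else s) with h | h
    · omega
    · exfalso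
      refine hmax ⟨v * cs.simple (if Even n then t else s), ?_, by omega⟩
      rw [CoxeterSystem.alternatingWord_succ', cs.wordProd_cons, mul_assoc,
        cs.simple_mul_simple_cancel_left, hv]
  have hn : n ≠ 0 := by
    rintro rfl
    have : w = v := by simpa [CoxeterSystem.alternatingWord] using hv
    subst this
    simp at nxt
    omega
  obtain ⟨k, rfl⟩ := Nat.exists_eq_succ_of_ne_zero hn
  have prv : cs.length v < cs.length (v * cs.simple (if Even k then t else s)) := by
    rcases cs.length_mul_simple v (if Even k then t else s) with h | h
    · omega
    · exfalso
      have : w = (v * cs.simple (if Even k then t else s)) *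
          cs.wordProd (CoxeterSystem.alternatingWord s t k) := by
        rw [hv, Nat.succ_eq_add_one, CoxeterSystem.alternatingWord_succ', cs.wordProd_cons,
          mul_assoc]
      have h2 := cs.length_mul_le (v * cs.simple (if Even k then t else s))
        (cs.wordProd (CoxeterSystem.alternatingWord s t k))
      rw [← this] at h2
      have := length_alt_le cs s t k
      omega
  have hs' : cs.length v < cs.length (v * cs.simple s) := by
    by_cases hk : Even k
    · have : ¬ Even (k + 1) := by simpa [Nat.even_add_one] using hk
      simpa [this] using nxt
    · simpa [hk] using prv
  have ht' : cs.length v < cs.length (v * cs.simple t) := by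
    by_cases hk : Even k
    · simpa [hk] using prv
    · have : Even (k + 1) := by simpa [Nat.even_add_one] using hk
      simpa [this] using nxt
  have ps := ih (cs.length v) (by omega) v s rfl hs'
  have pt := ih (cs.length v) (by omega) v t rfl ht'
  have hlt : M s t = 0 ∨ k + 1 + 1 ≤ M s t := by
    by_contra hcon
    push Not at hcon
    obtain ⟨y, hy, hy2⟩ := alt_suffix cs s t (M s t) (k + 1) (by omega)
    have hbr : cs.wordProd (CoxeterSystem.alternatingWord s t (M s t)) =
      cs.wordProd (CoxeterSystem.alternatingWord t s (M s t)) := by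
      have := cs.wordProd_braidWord_eq s t
      simpa [CoxeterSystem.braidWord, M.symmetric t s] using this
    obtain ⟨j, hj⟩ := Nat.exists_eq_succ_of_ne_zero hcon.1
    have e : w * cs.simple s = v * y * cs.wordProd (CoxeterSystem.alternatingWord s t j) := by
      rw [hv, Nat.succ_eq_add_one, hy2, hbr, hj, Nat.succ_eq_add_one,
        CoxeterSystem.alternatingWord, cs.wordProd_concat]
      simp [mul_assoc]
    have l1 := cs.length_mul_le (v * y) (cs.wordProd (CoxeterSystem.alternatingWord s t j))
    have l2 := cs.length_mul_le v y
    have l3 := length_alt_le cs s t j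
    rw [← e] at l1
    omega
  obtain ⟨a, b, ha, hb', hab⟩ := rep_alt cs s t (k + 1)
  have hm1 := M.off_diagonal s t hst
  rw [hv, rep_mul, Nat.succ_eq_add_one, hab, map_add, map_smul, map_smul]
  have c1 := cS_nonneg (M s t) a hm1 (by omega)
  have c2 := cS_nonneg (M s t) b hm1 (by omega)
  exact add_nonneg (smul_nonneg c1 ps) (smul_nonneg c2 pt)

lemma rep_pos (w : W) (s : B) (h : cs.length w < cs.length (w * cs.simple s)) :
    0 ≤ rep cs w (al s) := pos_aux cs _ w s rfl h

lemma rep_neg (w : W) (s : B) (h : cs.length (w * cs.simple s) < cs.length w) :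
    rep cs w (al s) ≤ 0 := by
  have := rep_pos cs (w * cs.simple s) s (by simpa [mul_assoc] using h)
  rw [rep_mul, rep_simple, sg_apply, bf_self] at this
  have e : (al s : B → ℝ) - ((2 : ℝ) * 1) • al s = - al s := by
    ext k; simp only [Pi.sub_apply, Pi.smul_apply, smul_eq_mul, Pi.neg_apply]; ring
  rw [e, map_neg] at this
  exact neg_nonneg.1 this

/-- roots -/
def IsRt (β : B → ℝ) : Prop := ∃ w s, β = rep cs w (al s)

lemma IsRt.rep {β : B → ℝ} (h : IsRt cs β) (g : W) : IsRt cs (rep cs g β) := by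
  obtain ⟨w, s, rfl⟩ := h
  exact ⟨g * w, s, by rw [rep_mul]⟩

lemma IsRt.pos_or {β : B → ℝ} (h : IsRt cs β) : 0 ≤ β ∨ β ≤ 0 := by
  obtain ⟨w, s, rfl⟩ := h
  rcases cs.length_mul_simple w s with h | h
  · left; exact rep_pos cs w s (by omega)
  · right; exact rep_neg cs w s (by omega)

lemma IsRt.norm {β : B → ℝ} (h : IsRt cs β) : bf M β β = 1 := by
  obtain ⟨w, s, rfl⟩ := h
  rw [bf_rep, bf_self]

lemma IsRt.eq_al {β : B → ℝ} (h : IsRt cs β) (hp : 0 ≤ β) (s : B)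
    (hn : EvenCox.rep cs (cs.simple s) β ≤ 0) : β = al s := by
  have hz : ∀ k, k ≠ s → β k = 0 := by
    intro k hk
    have h1 := hp k
    have h2 := hn k
    rw [rep_simple, sg_apply] at h2
    simp [al, hk] at h2 h1
    linarith
  have e : β = β s • al s := by
    ext k
    by_cases hk : k = s
    · subst hk; simp [al]
    · simp [al, hk, hz k hk]
  have hnrm := h.norm
  rw [e] at hnrm
  simp only [map_smul, LinearMap.smul_apply, bf_self, smul_eq_mul, mul_one] at hnrm
  have h1 := hp s
  simp only [Pi.zero_apply] at h1
  have : β s = 1 := by nlinarith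
  rw [e, this, one_smul]

lemma finite_inv (g : W) : {β | IsRt cs β ∧ 0 ≤ β ∧ rep cs g β ≤ 0}.Finite := by
  induction g using cs.simple_induction_left with
  | one =>
    refine Set.Finite.subset (Set.finite_empty) ?_
    rintro β ⟨h1, h2, h3⟩
    simp only [map_one, Module.End.one_apply] at h3
    have : β = 0 := le_antisymm h3 h2
    have := h1.norm
    simp_all
  | mul_simple_left g s ih =>
    refine Set.Finite.subset (ih.union (Set.finite_singleton (rep cs g⁻¹ (al s)))) ?_
    rintro β ⟨h1, h2, h3⟩
    rcases (h1.rep cs g).pos_or with h | h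
    · right
      rw [rep_mul] at h3
      have := (h1.rep cs g).eq_al cs h s h3
      rw [Set.mem_singleton_iff, ← this, rep_inv]
    · left; exact ⟨h1, h2, h⟩

end Root

end EvenCox



namespace EvenCox

section Par
variable {B W : Type*} [Group W] {M : CoxeterMatrix B} (cs : CoxeterSystem M W)

def par (T : Set B) : Subgroup W := Subgroup.closure (cs.simple '' T)

lemma simple_mem_par {T : Set B} {s : B} (h : s ∈ T) : cs.simple s ∈ par cs T :=
  Subgroup.subset_closure ⟨s, h, rfl⟩

end Par

def Sph {B : Type*} (M : CoxeterMatrix B) (T : Set B) : Prop :=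
  (∀ s ∈ T, ∀ t ∈ T, M s t ≠ 0) ∧
  ∀ s ∈ T, ∀ t ∈ T, ∀ u ∈ T, s ≠ t → t ≠ u → s ≠ u → M s t = 2 ∨ M t u = 2

section Tits

variable {B W : Type*} [Fintype B] [DecidableEq B] [Group W] {M : CoxeterMatrix B}
  (cs : CoxeterSystem M W)

noncomputable def rho : (B → ℝ) →ₗ[ℝ] ℝ := ∑ i, LinearMap.proj i

lemma rho_apply (v : B → ℝ) : rho v = ∑ i, v i := by simp [rho, LinearMap.sum_apply]

lemma rho_al (i : B) : rho (al i : B → ℝ) = 1 := by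
  rw [rho_apply]; simp [al]

lemma rho_pos {v : B → ℝ} (h : 0 ≤ v) (h0 : v ≠ 0) : 0 < rho v := by
  rw [rho_apply]
  rcases (Finset.sum_nonneg fun i _ => h i : 0 ≤ ∑ i, v i).lt_or_eq with h1 | h1
  · exact h1
  · exfalso; apply h0
    ext i
    exact (Finset.sum_eq_zero_iff_of_nonneg fun i _ => h i).1 h1.symm i (Finset.mem_univ i)

lemma IsRt.ne_zero {β : B → ℝ} (h : IsRt cs β) : β ≠ 0 := by
  rintro rfl
  have := h.norm
  simp at this

lemma sg_al (s : B) : sg M s (al s) = - al s := by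
  rw [sg_apply, bf_self]
  ext k; simp only [Pi.sub_apply, Pi.smul_apply, smul_eq_mul, Pi.neg_apply]; ring

lemma isRt_al (s : B) : IsRt cs (al s) := ⟨1, s, by simp⟩

lemma al_nonneg (s : B) : (0 : B → ℝ) ≤ al s := Pi.single_nonneg.2 zero_le_one

lemma al_not_nonpos (s : B) : ¬ (0 : B → ℝ) ≤ - al s := by
  intro h
  have := h s
  simp [al] at this
  linarith

variable (H : Subgroup W) [Fintype H]

noncomputable def xi : (B → ℝ) →ₗ[ℝ] ℝ := ∑ h : H, rho ∘ₗ (rep cs (h : W))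

lemma xi_apply (v : B → ℝ) : xi cs H v = ∑ h : H, rho (rep cs (h : W) v) := by
  simp [xi, LinearMap.sum_apply]

lemma xi_inv (h : W) (hh : h ∈ H) (v : B → ℝ) : xi cs H (rep cs h v) = xi cs H v := by
  rw [xi_apply, xi_apply]
  refine Fintype.sum_equiv (Equiv.mulRight (⟨h, hh⟩ : H)) _ _ fun k => ?_
  simp [rep_mul]

lemma xi_fin (w : W) : {β | IsRt cs β ∧ 0 ≤ β ∧ xi cs H (rep cs w β) ≤ 0}.Finite := by
  refine Set.Finite.subset (Set.finite_iUnion fun h : H => finite_inv cs (h * w)) ?_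
  rintro β ⟨h1, h2, h3⟩
  rw [xi_apply] at h3
  have : ∃ h : H, rho (rep cs (h : W) (rep cs w β)) ≤ 0 := by
    by_contra hcon
    push Not at hcon
    have := Finset.sum_pos (fun h _ => hcon h) (Finset.univ_nonempty (α := H))
    linarith
  obtain ⟨h, hh⟩ := this
  rw [Set.mem_iUnion]
  refine ⟨h, h1, h2, ?_⟩
  rcases (h1.rep cs ((h : W) * w)).pos_or with h4 | h4
  · exfalso
    have := rho_pos h4 ((h1.rep cs ((h : W) * w)).ne_zero)
    rw [rep_mul] at this
    linarith
  · exact h4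

lemma exists_w : ∃ w : W, ∀ s, 0 ≤ xi cs H (rep cs w (al s)) := by
  let A : W → Set (B → ℝ) := fun w => {β | IsRt cs β ∧ 0 ≤ β ∧ xi cs H (rep cs w β) < 0}
  have hA : ∀ w, (A w).Finite := fun w =>
    (xi_fin cs H w).subset fun β hβ => ⟨hβ.1, hβ.2.1, hβ.2.2.le⟩
  obtain ⟨w, hw⟩ : ∃ w, ∀ u, (A w).ncard ≤ (A u).ncard := by
    have hne : (Set.range fun w => (A w).ncard).Nonempty := ⟨_, 1, rfl⟩
    obtain ⟨w, hw⟩ := Nat.sInf_mem hne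
    refine ⟨w, fun u => ?_⟩
    have := Nat.sInf_le (Set.mem_range_self (f := fun w => (A w).ncard) u)
    simp only at hw this
    omega
  refine ⟨w, fun s => ?_⟩
  by_contra hs
  push Not at hs
  have hmem : al s ∈ A w := ⟨isRt_al cs s, al_nonneg s, hs⟩
  have h1 : (A (w * cs.simple s)).ncard ≤ (A w \ {al s}).ncard := by
    refine Set.ncard_le_ncard_of_injOn (fun β => rep cs (cs.simple s) β) ?_ ?_ ((hA w).diff)
    · rintro β ⟨b1, b2, b3⟩
      rw [rep_mul] at b3
      refine ⟨⟨b1.rep cs _, ?_, b3⟩, ?_⟩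
      · rcases (b1.rep cs (cs.simple s)).pos_or with h4 | h4
        · exact h4
        · exfalso
          have := b1.eq_al cs b2 s h4
          subst this
          rw [rep_simple, sg_al, map_neg, map_neg] at b3
          linarith
      · intro h
        have h : rep cs (cs.simple s) β = al s := h
        have e := congrArg (sg M s) h
        rw [rep_simple, sg_sg, sg_al] at e
        rw [e] at b2
        exact al_not_nonpos s b2
    · intro a _ b _ hab
      have := congrArg (rep cs (cs.simple s)⁻¹) hab
      simpa only [rep_inv] using this
  have h2 := Set.ncard_diff_singleton_lt_of_mem hmem (hA w)
  have := hw (w * cs.simple s)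
  omega

lemma y_eq (y : (B → ℝ) →ₗ[ℝ] ℝ) (v : B → ℝ) : y v = ∑ i, v i * y (al i) := by
  conv_lhs => rw [vec_eq v]
  simp

lemma y_nonneg (y : (B → ℝ) →ₗ[ℝ] ℝ) (hy : ∀ s, 0 ≤ y (al s)) {v : B → ℝ} (hv : 0 ≤ v) :
    0 ≤ y v := by
  rw [y_eq]
  exact Finset.sum_nonneg fun i _ => mul_nonneg (hv i) (hy i)

lemma stab (y : (B → ℝ) →ₗ[ℝ] ℝ) (hy : ∀ s, 0 ≤ y (al s)) (N : ℕ) : ∀ u : W, cs.length u = N →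
    (∀ v, y (rep cs u v) = y v) → u ∈ par cs {s | y (al s) = 0} := by
  induction N using Nat.strong_induction_on with
  | _ N ih =>
  intro u hN hu
  by_cases h1 : u = 1
  · subst h1; exact one_mem _
  obtain ⟨s, hs⟩ := cs.exists_rightDescent_of_ne_one h1
  have hs : cs.length (u * cs.simple s) < cs.length u := hs
  have h2 := rep_neg cs u s hs
  have h3 : y (al s) = 0 := by
    have h4 := y_nonneg y hy (neg_nonneg.2 h2)
    rw [map_neg, hu] at h4
    have := hy s
    linarith
  have h5 := ih _ (by omega) (u * cs.simple s) rfl (fun v => by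
    rw [rep_mul, hu, rep_simple, sg_apply, map_sub, map_smul, h3]; simp)
  have : u = u * cs.simple s * cs.simple s := by simp [mul_assoc]
  rw [this]
  exact mul_mem h5 (simple_mem_par cs h3)

lemma no_vec (y : (B → ℝ) →ₗ[ℝ] ℝ) (hy : ∀ s, 0 ≤ y (al s))
    (hfin : {β | IsRt cs β ∧ 0 ≤ β ∧ y β ≤ 0}.Finite) (V : B → ℝ) (hV : 0 ≤ V) (s0 : B)
    (hs0 : 0 < V s0) (h1 : ∀ i, 0 < V i → y (al i) = 0)
    (h2 : ∀ i, 0 < V i → bf M (al i) V ≤ 0) : False := by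
  let R : Set (B → ℝ) := {β | IsRt cs β ∧ 0 ≤ β ∧ ∀ i, ¬ 0 < V i → β i = 0}
  have hR : R.Finite := hfin.subset (by
    rintro β ⟨b1, b2, b3⟩
    refine ⟨b1, b2, ?_⟩
    rw [y_eq]
    refine (Finset.sum_eq_zero fun i _ => ?_).le
    by_cases hi : 0 < V i
    · rw [h1 i hi, mul_zero]
    · rw [b3 i hi, zero_mul])
  have hne : R.Nonempty := ⟨al s0, isRt_al cs s0, al_nonneg s0, fun i hi => by
    have : i ≠ s0 := by rintro rfl; exact hi hs0
    simp [al, this]⟩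
  obtain ⟨β, ⟨b1, b2, b3⟩, hmax⟩ := Set.exists_max_image R rho hR hne
  have hc : ∀ i, 0 < V i → 0 ≤ bf M (al i) β := by
    intro i hi
    by_contra hneg
    push Not at hneg
    have hmem : rep cs (cs.simple i) β ∈ R := by
      refine ⟨b1.rep cs _, ?_, ?_⟩
      · rw [rep_simple, sg_apply, sub_eq_add_neg, ← neg_smul]
        exact add_nonneg b2 (smul_nonneg (by linarith) (al_nonneg i))
      · intro j hj
        have : j ≠ i := by rintro rfl; exact hj hi
        rw [rep_simple, sg_apply]
        simp [al, this, b3 j hj]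
    have := hmax _ hmem
    rw [rep_simple, sg_apply, map_sub, map_smul, rho_al, smul_eq_mul] at this
    linarith
  have e1 : bf M β V = ∑ i, V i * bf M (al i) β := by
    rw [bf_right]
    exact Finset.sum_congr rfl fun i _ => by rw [bf_symm]
  have nn : ∀ i ∈ Finset.univ, 0 ≤ V i * bf M (al i) β := fun i _ => by
    by_cases hi : 0 < V i
    · exact mul_nonneg hi.le (hc i hi)
    · have : V i = 0 := le_antisymm (not_lt.1 hi) (hV i)
      rw [this, zero_mul]
  have e2 : bf M β V ≤ 0 := by
    rw [bf_left]
    refine Finset.sum_nonpos fun i _ => ?_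
    by_cases hi : 0 < V i
    · exact mul_nonpos_of_nonneg_of_nonpos (b2 i) (h2 i hi)
    · rw [b3 i hi, zero_mul]
  have e3 : ∑ i, V i * bf M (al i) β = 0 :=
    le_antisymm (e1 ▸ e2) (Finset.sum_nonneg nn)
  have e4 := (Finset.sum_eq_zero_iff_of_nonneg nn).1 e3
  have e5 : bf M β β = 0 := by
    rw [bf_left]
    refine Finset.sum_eq_zero fun i hi => ?_
    by_cases hi' : 0 < V i
    · rcases mul_eq_zero.1 (e4 i hi) with h | h
      · exact absurd h hi'.ne'
      · rw [h, mul_zero]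
    · rw [b3 i hi', zero_mul]
  rw [b1.norm] at e5
  exact one_ne_zero e5

lemma cos_nonneg_M (i j : B) (h : i ≠ j) : 0 ≤ Real.cos (Real.pi / M i j) := by
  have h1 := M.off_diagonal i j h
  rcases Nat.eq_zero_or_pos (M i j) with h0 | h0
  · simp [h0]
  have hm2 : (2 : ℝ) ≤ M i j := by exact_mod_cast (by omega : 2 ≤ M i j)
  have hpi := Real.pi_pos
  apply Real.cos_nonneg_of_neg_pi_div_two_le_of_le
  · have : 0 ≤ Real.pi / M i j := by positivity
    linarith
  · exact div_le_div_of_nonneg_left hpi.le (by norm_num) hm2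

lemma cos_ge_M (i j : B) (h : 4 ≤ M i j) : √2 / 2 ≤ Real.cos (Real.pi / M i j) := by
  have hm2 : (4 : ℝ) ≤ M i j := by exact_mod_cast h
  have hpi := Real.pi_pos
  rw [← Real.cos_pi_div_four]
  apply Real.cos_le_cos_of_nonneg_of_le_pi
  · positivity
  · linarith
  · exact div_le_div_of_nonneg_left hpi.le (by norm_num) hm2

lemma bf_pair (i j : B) : bf M (al i) (al j) = -Real.cos (Real.pi / M i j) := bf_al M i j

lemma sph_of (heven : ∀ i j : B, i ≠ j → Even (M i j)) (y : (B → ℝ) →ₗ[ℝ] ℝ)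
    (hy : ∀ s, 0 ≤ y (al s))
    (hfin : {β | IsRt cs β ∧ 0 ≤ β ∧ y β ≤ 0}.Finite) : Sph M {s | y (al s) = 0} := by
  constructor
  · intro s hs t ht h0
    have hst : s ≠ t := by rintro rfl; simp at h0
    refine no_vec cs y hy hfin (al s + al t) (add_nonneg (al_nonneg _) (al_nonneg _)) s ?_ ?_ ?_
    · simp [al, hst]
    · intro i hi
      by_cases h1 : i = s
      · exact h1 ▸ hs
      by_cases h2 : i = t
      · exact h2 ▸ ht
      simp [al, h1, h2] at hi
    · intro i hi
      by_cases h1 : i = s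
      · subst h1; rw [map_add, bf_self, bf_al, h0]; simp
      by_cases h2 : i = t
      · subst h2; rw [map_add, bf_self, bf_al, M.symmetric, h0]; simp
      simp [al, h1, h2] at hi
  · intro s hs t ht u hu hst htu hsu
    by_contra hcon
    push Not at hcon
    have n1 : M s t ≠ 0 := by
      intro h0
      refine no_vec cs y hy hfin (al s + al t) (add_nonneg (al_nonneg _) (al_nonneg _)) s ?_ ?_ ?_
      · simp [al, hst]
      · intro i hi
        by_cases h1 : i = s
        · exact h1 ▸ hs
        by_cases h2 : i = t
        · exact h2 ▸ ht
        simp [al, h1, h2] at hi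
      · intro i hi
        by_cases h1 : i = s
        · subst h1; rw [map_add, bf_self, bf_al, h0]; simp
        by_cases h2 : i = t
        · subst h2; rw [map_add, bf_self, bf_al, M.symmetric, h0]; simp
        simp [al, h1, h2] at hi
    have n2 : M t u ≠ 0 := by
      intro h0
      refine no_vec cs y hy hfin (al t + al u) (add_nonneg (al_nonneg _) (al_nonneg _)) t ?_ ?_ ?_
      · simp [al, htu]
      · intro i hi
        by_cases h1 : i = t
        · exact h1 ▸ ht
        by_cases h2 : i = u
        · exact h2 ▸ hu
        simp [al, h1, h2] at hi
      · intro i hi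
        by_cases h1 : i = t
        · subst h1; rw [map_add, bf_self, bf_al, h0]; simp
        by_cases h2 : i = u
        · subst h2; rw [map_add, bf_self, bf_al, M.symmetric, h0]; simp
        simp [al, h1, h2] at hi
    have g1 : 4 ≤ M s t := by
      obtain ⟨k, hk⟩ := heven s t hst
      have := hcon.1
      omega
    have g2 : 4 ≤ M t u := by
      obtain ⟨k, hk⟩ := heven t u htu
      have := hcon.2
      omega
    have c1 := cos_ge_M s t g1
    have c2 := cos_ge_M t u g2
    have c3 := cos_nonneg_M (M := M) s u hsu
    have hq : √2 * √2 = 2 := Real.mul_self_sqrt (by norm_num)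
    have hq0 : 0 < √2 := by positivity
    refine no_vec cs y hy hfin (al s + √2 • al t + al u)
      (add_nonneg (add_nonneg (al_nonneg _) (smul_nonneg hq0.le (al_nonneg _))) (al_nonneg _))
      s ?_ ?_ ?_
    · simp [al, hst, hsu]
    · intro i hi
      by_cases h1 : i = s
      · exact h1 ▸ hs
      by_cases h2 : i = t
      · exact h2 ▸ ht
      by_cases h3 : i = u
      · exact h3 ▸ hu
      simp [al, h1, h2, h3] at hi
    · intro i hi
      by_cases h1 : i = s
      · subst h1; rw [map_add, map_add, map_smul, bf_self, bf_al, bf_al, smul_eq_mul]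
        nlinarith
      by_cases h2 : i = t
      · subst h2; rw [map_add, map_add, map_smul, bf_self, bf_al, bf_al, smul_eq_mul,
          M.symmetric i s]
        nlinarith
      by_cases h3 : i = u
      · subst h3; rw [map_add, map_add, map_smul, bf_self, bf_al, bf_al, smul_eq_mul,
          M.symmetric i s, M.symmetric i t]
        nlinarith
      simp [al, h1, h2, h3] at hi

end Tits

theorem tits {B W : Type*} [Finite B] [Group W] {M : CoxeterMatrix B}
    (cs : CoxeterSystem M W) (heven : ∀ i j : B, i ≠ j → Even (M i j))
    (H : Subgroup W) [Finite H] :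
    ∃ T : Set B, Sph M T ∧ ∃ g : W, ∀ h ∈ H, g * h * g⁻¹ ∈ par cs T := by
  classical
  have := Fintype.ofFinite B
  have := Fintype.ofFinite H
  obtain ⟨w, hw⟩ := exists_w cs H
  refine ⟨{s | (xi cs H ∘ₗ rep cs w) (al s) = 0}, sph_of cs heven _ hw (xi_fin cs H w), w⁻¹, ?_⟩
  intro h hh
  refine stab cs _ hw _ _ rfl fun v => ?_
  simp only [LinearMap.comp_apply]
  rw [← rep_mul]
  have : w * (w⁻¹ * h * w⁻¹⁻¹) = h * w := by group
  rw [this, rep_mul, xi_inv cs H h hh]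

end EvenCox



namespace EvenCox

lemma comm_closure {W G : Type*} [Group W] [Group G] (f : W →* G) {A C : Set W}
    (h : ∀ a ∈ A, ∀ c ∈ C, Commute (f a) (f c)) :
    ∀ x ∈ Subgroup.closure A, ∀ y ∈ Subgroup.closure C, Commute (f x) (f y) := by
  have h1 : ∀ a ∈ A, ∀ y ∈ Subgroup.closure C, Commute (f a) (f y) := by
    intro a ha y hy
    induction hy using Subgroup.closure_induction with
    | mem y hy => exact h a ha y hy
    | one => rw [map_one]; exact Commute.one_right _
    | mul y z _ _ hy hz => rw [map_mul]; exact hy.mul_right hz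
    | inv y _ hy => rw [map_inv]; exact hy.inv_right
  intro x hx y hy
  induction hx using Subgroup.closure_induction with
  | mem x hx => exact h1 x hx y hy
  | one => rw [map_one]; exact Commute.one_left _
  | mul y z _ _ hy hz => rw [map_mul]; exact hy.mul_left hz
  | inv y _ hy => rw [map_inv]; exact hy.inv_left

lemma q1 {n : ℕ} (a b : DihedralGroup n) (ha : a * a = 1) (hb : b * b = 1)
    (hab : (a * b) ^ 2 ≠ 1) : (∃ i, a = .sr i) ∧ ∃ i, b = .sr i := by
  rcases a with i | i <;> rcases b with j | j
  · exfalso; apply hab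
    simp only [DihedralGroup.r_mul_r, DihedralGroup.one_def, DihedralGroup.r.injEq, pow_two] at *
    linear_combination ha + hb
  · exfalso; apply hab
    simp only [DihedralGroup.r_mul_sr, DihedralGroup.sr_mul_sr, DihedralGroup.one_def,
      DihedralGroup.r.injEq, pow_two] at *
    ring
  · exfalso; apply hab
    simp only [DihedralGroup.sr_mul_r, DihedralGroup.sr_mul_sr, DihedralGroup.one_def,
      DihedralGroup.r.injEq, pow_two] at *
    ring
  · exact ⟨⟨i, rfl⟩, ⟨j, rfl⟩⟩

lemma q2 {n : ℕ} (a b u : DihedralGroup n) (ha : a * a = 1) (hb : b * b = 1)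
    (hab : (a * b) ^ 2 ≠ 1) (hua : Commute u a) (hub : Commute u b) : ∃ i, u = .r i := by
  obtain ⟨⟨i, rfl⟩, ⟨j, rfl⟩⟩ := q1 a b ha hb hab
  rcases u with k | k
  · exact ⟨k, rfl⟩
  · exfalso; apply hab
    have h1 := hua.eq
    have h2 := hub.eq
    simp only [DihedralGroup.sr_mul_sr, DihedralGroup.r_mul_r, DihedralGroup.one_def,
      DihedralGroup.r.injEq, pow_two] at *
    linear_combination h2 - h1

def Big {B : Type*} (M : CoxeterMatrix B) (s t : B) : Prop := s ≠ t ∧ M s t ≠ 0 ∧ M s t ≠ 2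

lemma Big.symm {B : Type*} {M : CoxeterMatrix B} {s t : B} (h : Big M s t) : Big M t s :=
  ⟨h.1.symm, by rw [M.symmetric]; exact h.2.1, by rw [M.symmetric]; exact h.2.2⟩

lemma Big.le {B : Type*} {M : CoxeterMatrix B} (heven : ∀ i j : B, i ≠ j → Even (M i j))
    {s t : B} (h : Big M s t) : 4 ≤ M s t := by
  obtain ⟨h1, h2, h3⟩ := h
  obtain ⟨k, hk⟩ := heven s t h1
  omega

section Homs

variable {B W : Type*} [Group W] {M : CoxeterMatrix B} (cs : CoxeterSystem M W)
  (heven : ∀ i j : B, i ≠ j → Even (M i j))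

include heven in
lemma liftable_of {G : Type*} [Group G] (f : B → G) (h1 : ∀ i, f i * f i = 1)
    (h2 : ∀ i j, i ≠ j → f i ≠ 1 → f j ≠ 1 → (f i * f j) ^ M i j = 1) : M.IsLiftable f := by
  intro i j
  by_cases hij : i = j
  · subst hij; rw [h1, one_pow]
  by_cases hi : f i = 1
  · obtain ⟨k, hk⟩ := heven i j hij
    rw [hi, one_mul, hk, ← two_mul, pow_mul, pow_two, h1, one_pow]
  by_cases hj : f j = 1
  · obtain ⟨k, hk⟩ := heven i j hij
    rw [hj, mul_one, hk, ← two_mul, pow_mul, pow_two, h1, one_pow]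
  exact h2 i j hij hi hj

open Classical in
noncomputable def dihF (M : CoxeterMatrix B) (s t : B) (u : B) : DihedralGroup (M s t) :=
  if u = s then .sr 0 else if u = t then .sr 1 else 1

include heven in
lemma dihF_liftable (s t : B) : M.IsLiftable (dihF M s t) := by
  apply liftable_of heven
  · intro i; unfold dihF; split_ifs <;> simp
  · intro i j hij hi hj
    unfold dihF at *
    split_ifs at * with h1 h2 h3 h4 h5 h6
    · exact absurd (h1.trans h2.symm) hij
    · subst h1; subst h3; simp
    · exact absurd rfl hj
    · subst h4; subst h5
      have e : (DihedralGroup.sr 1 * DihedralGroup.sr 0 : DihedralGroup (M j i)) =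
        (DihedralGroup.r 1)⁻¹ := by simp
      have e2 : M i j = M j i := M.symmetric i j
      rw [e, e2, inv_pow]; simp
    · exact absurd (h4.trans h6.symm) hij
    · exact absurd rfl hj
    all_goals exact absurd rfl hi

noncomputable def dih (s t : B) : W →* DihedralGroup (M s t) :=
  cs.lift ⟨dihF M s t, dihF_liftable heven s t⟩

lemma dih_simple (s t u : B) : dih cs heven s t (cs.simple u) = dihF M s t u :=
  cs.lift_apply_simple (dihF_liftable heven s t) u

lemma dih_left (s t : B) : dih cs heven s t (cs.simple s) = .sr 0 := by
  rw [dih_simple]; simp [dihF]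

lemma dih_right (s t : B) (h : s ≠ t) : dih cs heven s t (cs.simple t) = .sr 1 := by
  rw [dih_simple]; simp [dihF, h.symm]

lemma dih_other (s t u : B) (h1 : u ≠ s) (h2 : u ≠ t) : dih cs heven s t (cs.simple u) = 1 := by
  rw [dih_simple]; simp [dihF, h1, h2]

lemma dih_mul_self (s t u : B) :
    dih cs heven s t (cs.simple u) * dih cs heven s t (cs.simple u) = 1 := by
  rw [← map_mul, cs.simple_mul_simple_self, map_one]

lemma dih_st (s t : B) (h : s ≠ t) (n : ℤ) :
    dih cs heven s t ((cs.simple s * cs.simple t) ^ n) = .r n := by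
  rw [map_zpow, map_mul, dih_left, dih_right cs heven s t h]
  simp

lemma dih_c (s t : B) (h : s ≠ t) :
    dih cs heven s t ((cs.simple s * cs.simple t) ^ 2) = .r 2 := by
  have := dih_st cs heven s t h 2
  simpa using this

lemma r_two_ne {n : ℕ} (h : 4 ≤ n) : (DihedralGroup.r 2 : DihedralGroup n) ≠ 1 := by
  rw [DihedralGroup.one_def, Ne, DihedralGroup.r.injEq]
  intro h2
  have : ((2 : ℕ) : ZMod n) = 0 := by exact_mod_cast h2
  rw [ZMod.natCast_eq_zero_iff] at this
  have := Nat.le_of_dvd (by norm_num) this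
  omega

open Classical in
noncomputable def vF (i : B) : Multiplicative (B → ZMod 2) := Multiplicative.ofAdd (Pi.single i 1)

lemma zz (a : B → ZMod 2) : a + a = 0 := by
  ext k; simp [CharTwo.add_self_eq_zero]

include heven in
lemma vF_liftable : M.IsLiftable (vF : B → Multiplicative (B → ZMod 2)) := by
  have key : ∀ a : Multiplicative (B → ZMod 2), a * a = 1 := fun a => zz (Multiplicative.toAdd a)
  apply liftable_of heven
  · intro i; exact key _
  · intro i j hij _ _
    obtain ⟨k, hk⟩ := heven i j hij
    rw [hk, ← two_mul, pow_mul, pow_two, key, one_pow]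

noncomputable def vv : W →* Multiplicative (B → ZMod 2) := cs.lift ⟨vF, vF_liftable heven⟩

noncomputable def vec (w : W) : B → ZMod 2 := Multiplicative.toAdd (vv cs heven w)

lemma vec_mul (x y : W) : vec cs heven (x * y) = vec cs heven x + vec cs heven y := by
  simp [vec]

lemma vec_one : vec cs heven 1 = 0 := by simp [vec]

lemma vec_inv (x : W) : vec cs heven x⁻¹ = vec cs heven x := by
  have h := vec_mul cs heven x⁻¹ x
  rw [inv_mul_cancel, vec_one] at h
  have h2 := zz (vec cs heven x)
  exact add_right_cancel (h.symm.trans h2.symm)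

lemma vec_conj (g x : W) : vec cs heven (g * x * g⁻¹) = vec cs heven x := by
  rw [vec_mul, vec_mul, vec_inv, add_comm (vec cs heven g), add_assoc, zz, add_zero]

lemma vec_sq (x : W) : vec cs heven (x ^ 2) = 0 := by rw [pow_two, vec_mul, zz]

open Classical in
lemma vec_simple (i : B) : vec cs heven (cs.simple i) = Pi.single i 1 := by
  unfold vec vv
  rw [cs.lift_apply_simple (vF_liftable heven) i]; rfl

lemma vec_par {T : Set B} {x : W} (hx : x ∈ par cs T) (i : B) (hi : vec cs heven x i ≠ 0) :
    i ∈ T := by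
  classical
  by_contra hT
  apply hi
  induction hx using Subgroup.closure_induction with
  | mem x hx =>
    obtain ⟨s, hs, rfl⟩ := hx
    rw [vec_simple]
    have : i ≠ s := by rintro rfl; exact hT hs
    simp [this]
  | one => simp [vec_one]
  | mul x y _ _ hx hy =>
    rw [vec_mul, Pi.add_apply]
    have : vec cs heven x i = 0 := by by_contra h; exact h (hx h)
    have : vec cs heven y i = 0 := by by_contra h; exact h (hy h)
    simp [*]
  | inv x _ hx => rw [vec_inv]; by_contra h; rw [vec_inv] at *; exact h (hx h)

lemma parity (s t : B) (hst : s ≠ t) (x : W) :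
    (vec cs heven x s + vec cs heven x t = 0 ∧ ∃ i, dih cs heven s t x = .r i) ∨
    (vec cs heven x s + vec cs heven x t = 1 ∧ ∃ i, dih cs heven s t x = .sr i) := by
  classical
  induction x using cs.simple_induction with
  | simple u =>
    rw [vec_simple]
    by_cases h1 : u = s
    · subst h1; right; simp [dih_left, hst.symm]
    by_cases h2 : u = t
    · subst h2; right; simp [dih_right cs heven s u hst, hst]
    · left
      have h1' : s ≠ u := Ne.symm h1
      have h2' : t ≠ u := Ne.symm h2
      simp only [dih_other cs heven s t u h1 h2, Pi.single_eq_of_ne h1', Pi.single_eq_of_ne h2']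
      exact ⟨by simp, 0, rfl⟩
  | one => left; refine ⟨by simp [vec_one], 0, by simp⟩
  | mul x y hx hy =>
    rw [vec_mul, map_mul, Pi.add_apply, Pi.add_apply]
    have e : vec cs heven x s + vec cs heven y s + (vec cs heven x t + vec cs heven y t) =
      (vec cs heven x s + vec cs heven x t) + (vec cs heven y s + vec cs heven y t) := by ring
    rw [e]
    rcases hx with ⟨a, i, hi⟩ | ⟨a, i, hi⟩ <;> rcases hy with ⟨b, j, hj⟩ | ⟨b, j, hj⟩ <;>
      rw [a, b, hi, hj]
    · left; exact ⟨by decide, _, DihedralGroup.r_mul_r _ _⟩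
    · right; exact ⟨by decide, _, DihedralGroup.r_mul_sr _ _⟩
    · right; exact ⟨by decide, _, DihedralGroup.sr_mul_r _ _⟩
    · left; exact ⟨by decide, _, DihedralGroup.sr_mul_sr _ _⟩

lemma parity_sr (s t : B) (hst : s ≠ t) (x : W) (i) (h : dih cs heven s t x = .sr i) :
    vec cs heven x s + vec cs heven x t = 1 := by
  rcases parity cs heven s t hst x with ⟨-, j, hj⟩ | ⟨h, -⟩
  · rw [h] at hj; simp at hj
  · exact h

lemma parity_r (s t : B) (hst : s ≠ t) (x : W) (i) (h : dih cs heven s t x = .r i) :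
    vec cs heven x s + vec cs heven x t = 0 := by
  rcases parity cs heven s t hst x with ⟨h, -⟩ | ⟨-, j, hj⟩
  · exact h
  · rw [h] at hj; simp at hj

include heven in
lemma lemN_aux (s t : B) (hb : Big M s t) (T : Set B) (h : W)
    (hh : h * (cs.simple s * cs.simple t) ^ 2 * h⁻¹ ∈ par cs T) : s ∈ T := by
  by_contra hs
  have key : ∀ x ∈ par cs T, dih cs heven s t x = 1 ∨ dih cs heven s t x = .sr 1 := by
    intro x hx
    induction hx using Subgroup.closure_induction with
    | mem x hx =>
      obtain ⟨u, hu, rfl⟩ := hx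
      have h1 : u ≠ s := by rintro rfl; exact hs hu
      by_cases h2 : u = t
      · subst h2; right; exact dih_right cs heven s u hb.1
      · left; exact dih_other cs heven s t u h1 h2
    | one => left; exact map_one _
    | mul x y _ _ hx hy =>
      rw [map_mul]
      rcases hx with h1 | h1 <;> rcases hy with h2 | h2 <;> rw [h1, h2] <;> simp
    | inv x _ hx => rw [map_inv]; rcases hx with h1 | h1 <;> rw [h1] <;> simp
  have h1 := key _ hh
  rw [map_mul, map_mul, dih_c cs heven s t hb.1, map_inv] at h1
  rcases h1 with h1 | h1
  · rw [conj_eq_one_iff] at h1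
    exact r_two_ne (hb.le heven) h1
  · rcases hd : dih cs heven s t h with i | i <;> rw [hd] at h1 <;> simp at h1

include heven in
lemma lemN (s t : B) (hb : Big M s t) (T : Set B) (h : W)
    (hh : h * (cs.simple s * cs.simple t) ^ 2 * h⁻¹ ∈ par cs T) : s ∈ T ∧ t ∈ T := by
  refine ⟨lemN_aux cs heven s t hb T h hh, lemN_aux cs heven t s hb.symm T h ?_⟩
  have e : cs.simple t * cs.simple s = (cs.simple s * cs.simple t)⁻¹ := by simp
  rw [e, inv_pow, ← conj_inv]
  exact inv_mem hh

include heven in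
lemma dih_inj (s t : B) (hst : s ≠ t) (x : W) (hx : x ∈ par cs {s, t})
    (h : dih cs heven s t x = 1) : x = 1 := by
  have key : ∃ n : ℤ, x = (cs.simple s * cs.simple t) ^ n ∨
      x = (cs.simple s * cs.simple t) ^ n * cs.simple s := by
    clear h
    set a := cs.simple s with ha
    set b := cs.simple t with hb
    have haa : a * a = 1 := cs.simple_mul_simple_self s
    have hbb : b * b = 1 := cs.simple_mul_simple_self t
    have hai : a⁻¹ = a := cs.inv_simple s
    have hbi : b⁻¹ = b := cs.inv_simple t
    have hsw : ∀ n : ℤ, a * (a * b) ^ n = (a * b) ^ (-n) * a := by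
      intro n
      have : a * (a * b) ^ n * a⁻¹ = (a * b) ^ (-n) := by
        rw [← conj_zpow, zpow_neg, ← inv_zpow]
        congr 1
        rw [mul_inv_rev, hai, hbi, ← mul_assoc, haa, one_mul]
      rw [← this]; group
    have hb2 : b = (a * b) ^ (-1 : ℤ) * a := by
      rw [zpow_neg_one, mul_inv_rev, hai, hbi, mul_assoc, haa, mul_one]
    induction hx using Subgroup.closure_induction with
    | mem x hx =>
      obtain ⟨u, hu, rfl⟩ := hx
      rcases hu with rfl | hu
      · exact ⟨0, Or.inr (by simp [ha])⟩
      · rw [Set.mem_singleton_iff] at hu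
        subst hu
        exact ⟨-1, Or.inr hb2⟩
    | one => exact ⟨0, Or.inl (by simp)⟩
    | mul x y _ _ hx hy =>
      obtain ⟨n, hn⟩ := hx
      obtain ⟨k, hk⟩ := hy
      rcases hn with rfl | rfl <;> rcases hk with rfl | rfl
      · exact ⟨n + k, Or.inl (by rw [zpow_add])⟩
      · exact ⟨n + k, Or.inr (by rw [zpow_add, mul_assoc])⟩
      · exact ⟨n - k, Or.inr (by rw [mul_assoc, hsw, ← mul_assoc, ← zpow_add, sub_eq_add_neg])⟩
      · exact ⟨n - k, Or.inl (by
          rw [mul_assoc, ← mul_assoc a, hsw, mul_assoc, haa, mul_one, ← zpow_add, sub_eq_add_neg])⟩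
    | inv x _ hx =>
      obtain ⟨n, rfl | rfl⟩ := hx
      · exact ⟨-n, Or.inl (by rw [zpow_neg])⟩
      · exact ⟨n, Or.inr (by rw [mul_inv_rev, ← zpow_neg, hai, hsw, neg_neg])⟩
  obtain ⟨n, rfl | rfl⟩ := key
  · rw [dih_st cs heven s t hst, DihedralGroup.one_def, DihedralGroup.r.injEq] at h
    have : ((M s t : ℕ) : ℤ) ∣ n := (ZMod.intCast_zmod_eq_zero_iff_dvd n (M s t)).1 h
    obtain ⟨k, rfl⟩ := this
    rw [zpow_mul, zpow_natCast, cs.simple_mul_simple_pow, one_zpow]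
  · rw [map_mul, dih_st cs heven s t hst, dih_left] at h
    simp at h
    rw [DihedralGroup.one_def] at h
    cases h

lemma split {T f : Set B} (hf : f ⊆ T)
    (hc : ∀ s ∈ f, ∀ t ∈ T, t ∉ f → Commute (cs.simple s) (cs.simple t)) {x : W}
    (hx : x ∈ par cs T) : ∃ a ∈ par cs f, ∃ b ∈ par cs (T \ f), x = a * b := by
  have hcc : ∀ a ∈ par cs f, ∀ b ∈ par cs (T \ f), Commute a b := by
    have := comm_closure (MonoidHom.id W) (A := cs.simple '' f) (C := cs.simple '' (T \ f)) (by
      rintro _ ⟨s, hs, rfl⟩ _ ⟨t, ht, rfl⟩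
      exact hc s hs t ht.1 ht.2)
    exact this
  induction hx using Subgroup.closure_induction with
  | mem x hx =>
    obtain ⟨u, hu, rfl⟩ := hx
    by_cases h : u ∈ f
    · exact ⟨_, simple_mem_par cs h, 1, one_mem _, by simp⟩
    · exact ⟨1, one_mem _, _, simple_mem_par cs ⟨hu, h⟩, by simp⟩
  | one => exact ⟨1, one_mem _, 1, one_mem _, by simp⟩
  | mul x y _ _ hx hy =>
    obtain ⟨a, ha, b, hb, rfl⟩ := hx
    obtain ⟨c, hc', d, hd, rfl⟩ := hy
    refine ⟨a * c, mul_mem ha hc', b * d, mul_mem hb hd, ?_⟩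
    have := (hcc c hc' b hb).eq
    rw [mul_assoc, ← mul_assoc b, ← this]; simp only [mul_assoc]
  | inv x _ hx =>
    obtain ⟨a, ha, b, hb, rfl⟩ := hx
    refine ⟨a⁻¹, inv_mem ha, b⁻¹, inv_mem hb, ?_⟩
    rw [(hcc a ha b hb).eq, mul_inv_rev]

lemma comm_of_two {s t : B} (h : M s t = 2) : Commute (cs.simple s) (cs.simple t) := by
  have := cs.simple_mul_simple_pow s t
  rw [h, pow_two] at this
  have h2 := eq_inv_of_mul_eq_one_left this
  rw [mul_inv_rev, cs.inv_simple, cs.inv_simple] at h2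
  exact h2

lemma Sph.mono {T f : Set B} (h : Sph M T) (hf : f ⊆ T) : Sph M f :=
  ⟨fun s hs t ht => h.1 s (hf hs) t (hf ht), fun s hs t ht u hu =>
    h.2 s (hf hs) t (hf ht) u (hf hu)⟩

lemma Sph.two {T : Set B} (h : Sph M T) {s t u : B} (hs : s ∈ T) (ht : t ∈ T) (hu : u ∈ T)
    (hb : Big M s t) (h1 : u ≠ s) (h2 : u ≠ t) : M s u = 2 ∧ M t u = 2 := by
  constructor
  · rcases h.2 t ht s hs u hu hb.1.symm h1.symm h2.symm with h3 | h3
    · rw [M.symmetric] at h3; exact absurd h3 hb.2.2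
    · exact h3
  · rcases h.2 s hs t ht u hu hb.1 h2.symm h1.symm with h3 | h3
    · exact absurd h3 hb.2.2
    · exact h3

include heven in
lemma embed [Finite B] (R : B → B → Prop) (hR : ∀ s t, s ≠ t → R s t ∨ R t s) (N : ℕ) :
    ∀ T : Set B, T.ncard = N → Sph M T →
    ∀ x ∈ par cs T, vec cs heven x = 0 →
    (∀ s ∈ T, ∀ t ∈ T, Big M s t → R s t → dih cs heven s t x = 1) → x = 1 := by
  induction N using Nat.strong_induction_on with
  | _ N ih =>
  intro T hN hT x hx hv hd
  by_cases hemp : T = ∅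
  · subst hemp
    simpa [par] using hx
  obtain ⟨s, hs⟩ := Set.nonempty_iff_ne_empty.2 hemp
  by_cases hbig : ∃ t ∈ T, Big M s t
  · obtain ⟨t, ht, hb⟩ := hbig
    have hf : ({s, t} : Set B) ⊆ T := by
      rintro u (rfl | rfl)
      · exact hs
      · exact ht
    obtain ⟨a, ha, b, hbb, rfl⟩ := split cs hf (by
      rintro u hu w hw hwf
      simp only [Set.mem_insert_iff, Set.mem_singleton_iff, not_or] at hwf
      have := hT.two hs ht hw hb hwf.1 hwf.2
      rcases hu with rfl | rfl
      · exact comm_of_two cs this.1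
      · exact comm_of_two cs this.2) hx
    have triv : ∀ p q : B, ({p, q} : Set B) = {s, t} → dih cs heven p q b = 1 := by
      intro p q hpq
      have : par cs (T \ {s, t}) ≤ (dih cs heven p q).ker := by
        unfold par
        rw [Subgroup.closure_le]
        rintro _ ⟨u, hu, rfl⟩
        have hu2 := hu.2
        rw [← hpq] at hu2
        simp only [Set.mem_insert_iff, Set.mem_singleton_iff, not_or] at hu2
        exact dih_other cs heven p q u hu2.1 hu2.2
      exact this hbb
    have ha1 : a = 1 := by
      rcases hR s t hb.1 with h | h
      · have := hd s hs t ht hb h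
        rw [map_mul, triv s t rfl, mul_one] at this
        exact dih_inj cs heven s t hb.1 a ha this
      · have := hd t ht s hs hb.symm h
        rw [map_mul, triv t s (Set.pair_comm t s), mul_one] at this
        rw [Set.pair_comm] at ha
        exact dih_inj cs heven t s hb.1.symm a ha this
    subst ha1
    rw [one_mul] at *
    have hlt : (T \ {s, t}).ncard < T.ncard :=
      Set.ncard_lt_ncard ⟨Set.diff_subset, fun h => (h hs).2 (by simp)⟩ (Set.toFinite T)
    exact ih _ (hN ▸ hlt) _ rfl (hT.mono Set.diff_subset) b hbb hv
      (fun p hp q hq => hd p hp.1 q hq.1)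
  · have hf : ({s} : Set B) ⊆ T := by simpa using hs
    obtain ⟨a, ha, b, hbb, rfl⟩ := split cs hf (by
      rintro u hu w hw hwf
      rw [Set.mem_singleton_iff] at hu hwf
      subst hu
      apply comm_of_two
      by_contra hne
      exact hbig ⟨w, hw, fun h => hwf h.symm, hT.1 u hs w hw, hne⟩) hx
    have ha2 : a = 1 ∨ a = cs.simple s := by
      unfold par at ha
      rw [Set.image_singleton, ← Subgroup.zpowers_eq_closure] at ha
      obtain ⟨n, rfl⟩ := ha
      have h2 : cs.simple s ^ (2 : ℤ) = 1 := by
        have := cs.simple_sq s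
        exact_mod_cast this
      rcases Int.even_or_odd' n with ⟨k, rfl | rfl⟩
      · left; simp only; rw [zpow_mul, h2, one_zpow]
      · right; simp only; rw [zpow_add, zpow_mul, h2, one_zpow, one_mul, zpow_one]
    have ha1 : a = 1 := by
      rcases ha2 with h | h
      · exact h
      · exfalso
        have h2 := congrFun hv s
        classical
        rw [vec_mul, h, vec_simple, Pi.add_apply] at h2
        have h3 : vec cs heven b s = 0 := by
          by_contra h4
          exact (vec_par cs heven hbb s h4).2 rfl
        rw [h3] at h2
        simp at h2
    subst ha1
    rw [one_mul] at *
    have hlt : (T \ {s}).ncard < T.ncard :=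
      Set.ncard_lt_ncard ⟨Set.diff_subset, fun h => (h hs).2 (by simp)⟩ (Set.toFinite T)
    exact ih _ (hN ▸ hlt) _ rfl (hT.mono Set.diff_subset) b hbb hv
      (fun p hp q hq => hd p hp.1 q hq.1)

include heven in
lemma par_finite [Finite B] {T : Set B} (hT : Sph M T) : Finite (par cs T) := by
  let I := {p : B × B // Big M p.1 p.2}
  have hfin : ∀ p : I, Finite (DihedralGroup (M p.1.1 p.1.2)) := by
    intro p
    have : NeZero (M p.1.1 p.1.2) := ⟨p.2.2.1⟩
    exact Finite.of_fintype _
  let F : par cs T → (∀ p : I, DihedralGroup (M p.1.1 p.1.2)) × (B → ZMod 2) := fun x =>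
    (fun p => dih cs heven p.1.1 p.1.2 x, vec cs heven x)
  refine Finite.of_injective F ?_
  intro x y hxy
  have h1 : ∀ p : I, dih cs heven p.1.1 p.1.2 x = dih cs heven p.1.1 p.1.2 y :=
    fun p => congrFun (congrArg Prod.fst hxy) p
  have h2 : vec cs heven x = vec cs heven y := congrArg Prod.snd hxy
  have := embed cs heven (fun _ _ => True) (fun _ _ _ => Or.inl trivial) _ T rfl hT
    ((x : W) * (y : W)⁻¹) (mul_mem x.2 (inv_mem y.2))
    (by rw [vec_mul, vec_inv, h2, zz])
    (fun s hs t ht hb _ => by rw [map_mul, map_inv, h1 ⟨(s, t), hb⟩, mul_inv_cancel])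
  exact Subtype.ext (mul_inv_eq_one.1 this)

end Homs

end EvenCox



namespace EvenCox

section CC
variable {B W : Type*} [Group W] {M : CoxeterMatrix B} (cs : CoxeterSystem M W)
  (heven : ∀ i j : B, i ≠ j → Even (M i j))

def cc (s t : B) : W := (cs.simple s * cs.simple t) ^ 2

lemma cc_swap (s t : B) : cc cs t s = (cc cs s t)⁻¹ := by
  unfold cc; rw [← inv_pow]; simp

lemma cc_mem {T : Set B} {s t : B} (hs : s ∈ T) (ht : t ∈ T) : cc cs s t ∈ par cs T :=
  pow_mem (mul_mem (simple_mem_par cs hs) (simple_mem_par cs ht)) 2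

lemma cc_two {s t : B} (h : M s t = 2) : cc cs s t = 1 := by
  have := cs.simple_mul_simple_pow s t
  rwa [h] at this

include heven in
lemma cc_ne {s t : B} (h : Big M s t) : cc cs s t ≠ 1 := by
  intro h1
  have h2 := dih_c cs heven s t h.1
  unfold cc at h1
  rw [h1, map_one] at h2
  exact r_two_ne (h.le heven) h2.symm

include heven in
lemma cc_order {s t : B} (h : Big M s t) : M s t = 2 * orderOf (cc cs s t) := by
  have h1 : orderOf (cs.simple s * cs.simple t) = M s t := by
    apply Nat.dvd_antisymm
    · exact orderOf_dvd_of_pow_eq_one (cs.simple_mul_simple_pow s t)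
    · have := dih_st cs heven s t h.1 (orderOf (cs.simple s * cs.simple t))
      rw [zpow_natCast, pow_orderOf_eq_one, map_one, DihedralGroup.one_def,
        DihedralGroup.r.injEq, Int.cast_natCast] at this
      exact (ZMod.natCast_eq_zero_iff _ _).1 this.symm
  obtain ⟨k, hk⟩ := heven s t h.1
  unfold cc
  rw [orderOf_pow' _ two_ne_zero, h1, hk, ← two_mul]
  simp

end CC

section Core

variable {B B' W : Type*} [Group W] {M : CoxeterMatrix B} {M' : CoxeterMatrix B'}
  (cs : CoxeterSystem M W) (cs' : CoxeterSystem M' W)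
  (heven : ∀ i j : B, i ≠ j → Even (M i j)) (heven' : ∀ i j : B', i ≠ j → Even (M' i j))
  {T : Set B} {T' : Set B'}

def EE (M : CoxeterMatrix B) (T : Set B) (R : B → B → Prop) : Set (B × B) :=
  {p | p.1 ∈ T ∧ p.2 ∈ T ∧ Big M p.1 p.2 ∧ R p.1 p.2}

include heven in
lemma dsq (s t : B) (u : B') : dih cs heven s t (cs'.simple u) * dih cs heven s t (cs'.simple u) = 1 := by
  rw [← map_mul, cs'.simple_mul_simple_self, map_one]

include heven in
lemma relA (hT' : Sph M' T') (hW : par cs T = par cs' T') (R' : B' → B' → Prop)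
    (hR' : ∀ s t, s ≠ t → R' s t ∨ R' t s) (s t : B) (hs : s ∈ T) (ht : t ∈ T) (hb : Big M s t) :
    ∃ p' ∈ EE M' T' R', dih cs heven s t (cc cs' p'.1 p'.2) ≠ 1 := by
  by_contra hcon
  push Not at hcon
  have key : ∀ a ∈ T', ∀ b ∈ T', dih cs heven s t (cc cs' a b) = 1 := by
    intro a ha b hb
    by_cases hab : a = b
    · subst hab; simp [cc]
    by_cases h2 : M' a b = 2
    · rw [cc_two cs' h2, map_one]
    have hB : Big M' a b := ⟨hab, hT'.1 a ha b hb, h2⟩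
    rcases hR' a b hab with h | h
    · exact hcon (a, b) ⟨ha, hb, hB, h⟩
    · have := hcon (b, a) ⟨hb, ha, hB.symm, h⟩
      simp only at this
      rw [cc_swap, map_inv, this, inv_one]
  have hc : ∀ x ∈ par cs' T', ∀ y ∈ par cs' T',
      Commute (dih cs heven s t x) (dih cs heven s t y) := by
    apply comm_closure
    rintro _ ⟨a, ha, rfl⟩ _ ⟨b, hb, rfl⟩
    have := key a ha b hb
    unfold cc at this
    rw [map_pow, map_mul, pow_two] at this
    have h2 := eq_inv_of_mul_eq_one_left this
    rw [mul_inv_rev, ← map_inv, ← map_inv, cs'.inv_simple, cs'.inv_simple] at h2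
    exact h2
  rw [← hW] at hc
  have h3 := hc _ (simple_mem_par cs hs) _ (simple_mem_par cs ht)
  have h4 := dih_c cs heven s t hb.1
  rw [map_pow, map_mul, pow_two, mul_assoc, ← mul_assoc (dih cs heven s t (cs.simple t)), ← h3.eq,
    mul_assoc, dih_mul_self, mul_one, dih_mul_self] at h4
  exact r_two_ne (hb.le heven) h4.symm

include heven in
lemma relB (hT' : Sph M' T') (R' : B' → B' → Prop)
    (hR' : ∀ s t, R' s t → ¬ R' t s) (s t : B) (p q : B' × B') (hp : p ∈ EE M' T' R')
    (hq : q ∈ EE M' T' R') (h1 : dih cs heven s t (cc cs' p.1 p.2) ≠ 1)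
    (h2 : dih cs heven s t (cc cs' q.1 q.2) ≠ 1) : p = q := by
  obtain ⟨a, b⟩ := p
  obtain ⟨c, d⟩ := q
  obtain ⟨ha, hb, hab, rab⟩ := hp
  obtain ⟨hc, hd, hcd, rcd⟩ := hq
  simp only at *
  unfold cc at h1 h2
  rw [map_pow, map_mul] at h1 h2
  have key : ∀ u ∈ T', u ≠ a → u ≠ b → (u = c ∨ u = d) → False := by
    intro u hu hua hub hucd
    obtain ⟨e1, e2⟩ := hT'.two ha hb hu hab hua hub
    obtain ⟨i, hi⟩ := q2 _ _ (dih cs heven s t (cs'.simple u)) (dsq cs cs' heven s t a)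
      (dsq cs cs' heven s t b) h1
      ((comm_of_two cs' e1).symm.map _) ((comm_of_two cs' e2).symm.map _)
    obtain ⟨⟨j, hj⟩, ⟨k, hk⟩⟩ := q1 _ _ (dsq cs cs' heven s t c) (dsq cs cs' heven s t d) h2
    rcases hucd with rfl | rfl
    · rw [hi] at hj; cases hj
    · rw [hi] at hk; cases hk
  have hcab : c = a ∨ c = b := by
    by_contra h; push Not at h; exact key c hc h.1 h.2 (Or.inl rfl)
  have hdab : d = a ∨ d = b := by
    by_contra h; push Not at h; exact key d hd h.1 h.2 (Or.inr rfl)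
  have hn := hcd.1
  rcases hcab with rfl | rfl <;> rcases hdab with rfl | rfl
  · exact absurd rfl hn
  · rfl
  · exact absurd rcd (hR' _ _ rab)
  · exact absurd rfl hn

include heven heven' in
lemma relC [Finite B] (hT : Sph M T) (hW : par cs T = par cs' T') (R : B → B → Prop)
    (hR : ∀ s t, s ≠ t → R s t ∨ R t s) (a b : B') (ha : a ∈ T') (hb : b ∈ T') (hab : Big M' a b) :
    ∃ p ∈ EE M T R, dih cs heven p.1 p.2 (cc cs' a b) ≠ 1 := by
  by_contra hcon
  push Not at hcon
  apply cc_ne cs' heven' hab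
  refine embed cs heven R hR _ T rfl hT _ (hW ▸ cc_mem cs' ha hb) (vec_sq cs heven _) ?_
  intro s hs t ht hst r
  exact hcon (s, t) ⟨hs, ht, hst, r⟩

include heven heven' in
lemma EE_card [Finite B] [Finite B'] (hT : Sph M T) (hT' : Sph M' T') (hW : par cs T = par cs' T')
    (R : B → B → Prop) (hR : ∀ s t, s ≠ t → R s t ∨ R t s)
    (R' : B' → B' → Prop) (hRa' : ∀ s t, R' s t → ¬ R' t s) :
    (EE M' T' R').ncard ≤ (EE M T R).ncard := by
  have : ∀ p' : EE M' T' R', ∃ p : EE M T R, dih cs heven p.1.1 p.1.2 (cc cs' p'.1.1 p'.1.2) ≠ 1 := by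
    rintro ⟨p', h⟩
    obtain ⟨p, h1, h2⟩ := relC cs cs' heven heven' hT hW R hR p'.1 p'.2 h.1 h.2.1 h.2.2.1
    exact ⟨⟨p, h1⟩, h2⟩
  choose G hG using this
  refine Nat.card_le_card_of_injective G ?_
  intro p q hpq
  have h1 := hG p
  have h2 := hG q
  rw [← hpq] at h2
  exact Subtype.ext (relB cs cs' heven hT' R' hRa' _ _ p.1 q.1 p.2 q.2 h1 h2)

include heven heven' in
lemma core [Finite B] [Finite B'] (hT : Sph M T) (hT' : Sph M' T') (hW : par cs T = par cs' T')
    (s t : B) (hs : s ∈ T) (ht : t ∈ T) (hb : Big M s t) :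
    ∃ a ∈ T', ∃ b ∈ T', Big M' a b ∧ ∃ k : ℤ, cc cs' a b = cc cs s t ^ k := by
  have hR : ∀ x y : B, x ≠ y → WellOrderingRel x y ∨ WellOrderingRel y x := by
    intro x y hxy
    rcases trichotomous_of WellOrderingRel x y with h | h | h
    · exact Or.inl h
    · exact absurd h hxy
    · exact Or.inr h
  have hR' : ∀ x y : B', x ≠ y → WellOrderingRel x y ∨ WellOrderingRel y x := by
    intro x y hxy
    rcases trichotomous_of WellOrderingRel x y with h | h | h
    · exact Or.inl h
    · exact absurd h hxy
    · exact Or.inr h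
  have hRa : ∀ x y : B, WellOrderingRel x y → ¬ WellOrderingRel y x := fun x y h => asymm h
  have hRa' : ∀ x y : B', WellOrderingRel x y → ¬ WellOrderingRel y x := fun x y h => asymm h
  wlog hst : WellOrderingRel s t generalizing s t
  · obtain ⟨a, ha, b, hb', hab, k, hk⟩ := this t s ht hs hb.symm ((hR s t hb.1).resolve_left hst)
    refine ⟨a, ha, b, hb', hab, -k, ?_⟩
    rw [hk, cc_swap cs s t, inv_zpow, zpow_neg]
  set E := EE M T WellOrderingRel with hE
  set E' := EE M' T' WellOrderingRel with hE'
  have card : E.ncard ≤ E'.ncard := EE_card cs' cs heven' heven hT' hT hW.symm _ hR' _ hRa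
  have hF : ∀ p : E, ∃ p' : E', dih cs heven p.1.1 p.1.2 (cc cs' p'.1.1 p'.1.2) ≠ 1 := by
    intro p
    obtain ⟨p', h1, h2⟩ := relA cs cs' heven hT' hW _ hR' p.1.1 p.1.2 p.2.1 p.2.2.1 p.2.2.2.1
    exact ⟨⟨p', h1⟩, h2⟩
  choose F hF using hF
  have hFu : ∀ (p : E) (p' : E'), dih cs heven p.1.1 p.1.2 (cc cs' p'.1.1 p'.1.2) ≠ 1 →
      F p = p' := by
    intro p p' h
    exact Subtype.ext (relB cs cs' heven hT' _ hRa' _ _ _ _ (F p).2 p'.2 (hF p) h)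
  have hFs : Function.Surjective F := by
    intro p'
    obtain ⟨p, h1, h2⟩ := relC cs cs' heven heven' hT hW _ hR p'.1.1 p'.1.2 p'.2.1 p'.2.2.1
      p'.2.2.2.1
    exact ⟨⟨p, h1⟩, hFu ⟨p, h1⟩ p' h2⟩
  have hFi : Function.Injective F := by
    have hc : Nat.card E = Nat.card E' :=
      le_antisymm card (Nat.card_le_card_of_surjective F hFs)
    exact ((Nat.bijective_iff_surjective_and_card F).2 ⟨hFs, hc⟩).1
  let p : E := ⟨(s, t), hs, ht, hb, hst⟩
  obtain ⟨⟨⟨a, b⟩, ha, hb', hab, rab⟩, hp'⟩ : ∃ p', p' = F p := ⟨_, rfl⟩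
  simp only at ha hb' hab rab
  refine ⟨a, ha, b, hb', hab, ?_⟩
  have hne := hF p
  rw [← hp'] at hne
  simp only [p] at hne
  have hne0 := hne
  unfold cc at hne
  rw [map_pow, map_mul] at hne
  obtain ⟨⟨i, hi⟩, ⟨j, hj⟩⟩ := q1 _ _ (dsq cs cs' heven s t a) (dsq cs cs' heven s t b) hne
  obtain ⟨n, hn⟩ := ZMod.intCast_surjective (j - i)
  refine ⟨n, ?_⟩
  have hz : cc cs' a b * (cc cs s t ^ n)⁻¹ = 1 := by
    refine embed cs heven WellOrderingRel hR _ T rfl hT _ ?_ ?_ ?_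
    · exact mul_mem (hW ▸ cc_mem cs' ha hb') (inv_mem (zpow_mem (cc_mem cs hs ht) n))
    · have h2 : cc cs s t ^ n = ((cs.simple s * cs.simple t) ^ n) ^ 2 := by
        unfold cc; rw [← zpow_natCast, ← zpow_natCast, ← zpow_mul, ← zpow_mul, mul_comm]
      rw [vec_mul, vec_inv, h2, vec_sq]
      unfold cc
      rw [vec_sq, add_zero]
    · intro u hu w hw huw ruw
      by_cases hq : (u, w) = (s, t)
      · rw [Prod.mk.injEq] at hq
        obtain ⟨rfl, rfl⟩ := hq
        rw [map_mul, map_inv, map_zpow]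
        unfold cc
        rw [dih_c cs heven u w hb.1, map_pow, map_mul, hi, hj, mul_inv_eq_one]
        simp only [DihedralGroup.sr_mul_sr, pow_two, DihedralGroup.r_mul_r, ← hn,
          DihedralGroup.r_zpow]
        congr 1; ring
      · have e1 : dih cs heven u w (cc cs' a b) = 1 := by
          by_contra hc
          have := hFu ⟨(u, w), hu, hw, huw, ruw⟩ ⟨(a, b), ha, hb', hab, rab⟩ hc
          rw [hp'] at this
          exact hq (congrArg Subtype.val (hFi this))
        have e2 : dih cs heven u w (cc cs s t) = 1 := by
          have : (s ≠ u ∧ s ≠ w) ∨ (t ≠ u ∧ t ≠ w) := by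
            by_contra hcon
            have hst' := hb.1
            have : (s = u ∨ s = w) ∧ (t = u ∨ t = w) := by tauto
            rcases this with ⟨rfl | rfl, rfl | rfl⟩
            · exact hst' rfl
            · exact hq rfl
            · exact hRa _ _ hst ruw
            · exact hst' rfl
          unfold cc
          rw [map_pow, map_mul]
          rcases this with h | h
          · rw [dih_other cs heven u w s h.1 h.2, one_mul, pow_two, dih_mul_self]
          · rw [dih_other cs heven u w t h.1 h.2, mul_one, pow_two, dih_mul_self]
        rw [map_mul, map_inv, map_zpow, e1, e2]; simp
  exact mul_inv_eq_one.1 hz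

def Ep (s t : B) (a b : B') : Prop := Big M s t ∧ Big M' a b ∧
  (∃ (g : W) (k : ℤ), cc cs' a b = g * cc cs s t ^ k * g⁻¹) ∧
  (∃ (g : W) (k : ℤ), cc cs s t = g * cc cs' a b ^ k * g⁻¹)

def Tp (T : Set B) (T' : Set B') : Prop := Sph M T ∧ Sph M' T' ∧
  (∃ g : W, ∀ x ∈ par cs T, g * x * g⁻¹ ∈ par cs' T') ∧
  (∃ g : W, ∀ x ∈ par cs' T', g * x * g⁻¹ ∈ par cs T)

variable {cs cs'} in
lemma Ep.symm {s t : B} {a b : B'} (h : Ep cs cs' s t a b) : Ep cs' cs a b s t :=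
  ⟨h.2.1, h.1, h.2.2.2, h.2.2.1⟩

variable {cs cs'} in
lemma Tp.symm (h : Tp cs cs' T T') : Tp cs' cs T' T :=
  ⟨h.2.1, h.1, h.2.2.2, h.2.2.1⟩

variable {cs cs'} in
lemma Ep.swap {s t : B} {a b : B'} (h : Ep cs cs' s t a b) : Ep cs cs' t s a b := by
  obtain ⟨h1, h2, ⟨g, k, h3⟩, ⟨g', k', h4⟩⟩ := h
  refine ⟨h1.symm, h2, ⟨g, -k, ?_⟩, ⟨g', -k', ?_⟩⟩
  · rw [cc_swap cs s t, inv_zpow, zpow_neg, inv_inv]; exact h3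
  · rw [cc_swap cs s t, h4, zpow_neg]; group

variable {cs cs'} in
lemma Ep.swap' {s t : B} {a b : B'} (h : Ep cs cs' s t a b) : Ep cs cs' s t b a :=
  h.symm.swap.symm

end Core

end EvenCox



namespace EvenCox

section Facts

variable {B B' W : Type*} [Group W] {M : CoxeterMatrix B} {M' : CoxeterMatrix B'}
  {cs : CoxeterSystem M W} {cs' : CoxeterSystem M' W}
  (heven : ∀ i j : B, i ≠ j → Even (M i j)) (heven' : ∀ i j : B', i ≠ j → Even (M' i j))
  {T : Set B} {T' : Set B'}

lemma F1 (h : Tp cs cs' T T') {a : B'} (ha : a ∈ T') (i : B)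
    (hi : vec cs heven (cs'.simple a) i ≠ 0) : i ∈ T := by
  obtain ⟨g, hg⟩ := h.2.2.2
  refine vec_par cs heven (hg _ (simple_mem_par cs' ha)) i ?_
  rwa [vec_conj]

include heven' in
lemma F2 {s t : B} {a b : B'} (he : Ep cs cs' s t a b) (h : Tp cs cs' T T') (hs : s ∈ T)
    (ht : t ∈ T) : a ∈ T' ∧ b ∈ T' := by
  obtain ⟨g, hg⟩ := h.2.2.1
  obtain ⟨k, n, hk⟩ := he.2.2.1
  refine lemN cs' heven' a b he.2.1 T' (g * k⁻¹) ?_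
  change g * k⁻¹ * cc cs' a b * (g * k⁻¹)⁻¹ ∈ _
  have := hg _ (zpow_mem (cc_mem cs hs ht) n)
  rw [hk]
  convert this using 1
  group

include heven in
lemma dih_ne {s t : B} {a b : B'} (he : Ep cs cs' s t a b) :
    (dih cs heven s t (cs'.simple a) * dih cs heven s t (cs'.simple b)) ^ 2 ≠ 1 := by
  intro h1
  obtain ⟨g, k, hk⟩ := he.2.2.2
  have h2 := dih_c cs heven s t he.1.1
  change dih cs heven s t (cc cs s t) = _ at h2
  rw [← map_mul, ← map_pow] at h1
  change dih cs heven s t (cc cs' a b) = _ at h1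
  rw [hk, map_mul, map_mul, map_zpow, h1, one_zpow, mul_one, ← map_mul, mul_inv_cancel,
    map_one] at h2
  exact r_two_ne (he.1.le heven) h2.symm

lemma F3a {s t : B} {a b : B'} (he : Ep cs cs' s t a b) :
    vec cs heven (cs'.simple a) s + vec cs heven (cs'.simple a) t = 1 := by
  obtain ⟨⟨i, hi⟩, -⟩ := q1 _ _ (dsq cs cs' heven s t a) (dsq cs cs' heven s t b)
    (dih_ne heven he)
  exact parity_sr cs heven s t he.1.1 _ i hi

lemma F3b {s t : B} {a b : B'} (he : Ep cs cs' s t a b) (u : B') (h1 : M' a u = 2)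
    (h2 : M' b u = 2) :
    vec cs heven (cs'.simple u) s + vec cs heven (cs'.simple u) t = 0 := by
  obtain ⟨i, hi⟩ := q2 _ _ (dih cs heven s t (cs'.simple u)) (dsq cs cs' heven s t a)
    (dsq cs cs' heven s t b) (dih_ne heven he)
      ((comm_of_two cs' h1).symm.map _) ((comm_of_two cs' h2).symm.map _)
  exact parity_r cs heven s t he.1.1 _ i hi

include heven' in
lemma F4 {s t : B} {a b c d : B'} (h1 : Ep cs cs' s t a b) (h2 : Ep cs cs' s t c d) :
    (c = a ∧ d = b) ∨ (c = b ∧ d = a) := by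
  obtain ⟨g, k, hk⟩ := h1.2.2.2
  obtain ⟨g2, k2, hk2⟩ := h2.2.2.1
  have hm : cc cs' a b ∈ par cs' ({a, b} : Set B') := cc_mem cs' (by simp) (by simp)
  have := lemN cs' heven' c d h2.2.1 {a, b} (g⁻¹ * g2⁻¹) (by
    change g⁻¹ * g2⁻¹ * cc cs' c d * (g⁻¹ * g2⁻¹)⁻¹ ∈ _
    rw [hk2, hk]
    have e : g⁻¹ * g2⁻¹ * (g2 * (g * cc cs' a b ^ k * g⁻¹) ^ k2 * g2⁻¹) * (g⁻¹ * g2⁻¹)⁻¹ =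
      (cc cs' a b ^ k) ^ k2 := by
      rw [conj_zpow]; group
    rw [e]
    exact zpow_mem (zpow_mem hm _) _)
  have hn := h2.2.1.1
  rcases this with ⟨rfl | h3, rfl | h4⟩
  · exact absurd rfl hn
  · exact Or.inl ⟨rfl, h4⟩
  · exact Or.inr ⟨h3, rfl⟩
  · exact absurd (h3.trans h4.symm) hn

include heven heven' in
lemma F4label {s t : B} {a b : B'} (h : Ep cs cs' s t a b) : M s t = M' a b := by
  rw [cc_order cs heven h.1, cc_order cs' heven' h.2.1]
  congr 1
  obtain ⟨g, k, hk⟩ := h.2.2.1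
  obtain ⟨g2, k2, hk2⟩ := h.2.2.2
  apply Nat.dvd_antisymm
  · rw [orderOf_dvd_iff_pow_eq_one, hk2, conj_pow, ← zpow_natCast, ← zpow_mul, mul_comm, zpow_mul,
      zpow_natCast, pow_orderOf_eq_one]
    simp
  · rw [orderOf_dvd_iff_pow_eq_one, hk, conj_pow, ← zpow_natCast, ← zpow_mul, mul_comm, zpow_mul,
      zpow_natCast, pow_orderOf_eq_one]
    simp

lemma sph_pair (s t : B) (h : M s t ≠ 0) : Sph M ({s, t} : Set B) := by
  have h' : M t s ≠ 0 := by rwa [M.symmetric]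
  constructor
  · rintro a (rfl | ha) b (rfl | hb)
    · simp
    · rw [Set.mem_singleton_iff] at hb; subst hb; exact h
    · rw [Set.mem_singleton_iff] at ha; subst ha; exact h'
    · rw [Set.mem_singleton_iff] at ha hb; subst ha; subst hb; simp
  · intro a ha b hb c hc h1 h2 h3
    simp only [Set.mem_insert_iff, Set.mem_singleton_iff] at ha hb hc
    exfalso
    rcases ha with rfl | rfl <;> rcases hb with rfl | rfl <;> rcases hc with rfl | rfl <;> tauto

include heven heven' in
lemma F6 [Finite B] [Finite B'] (cs : CoxeterSystem M W) (cs' : CoxeterSystem M' W)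
    {s t : B} (h : M s t ≠ 0) : ∃ T T', Tp cs cs' T T' ∧ s ∈ T ∧ t ∈ T := by
  obtain ⟨T, hle, hmax⟩ := Set.Finite.exists_le_maximal (Set.toFinite {T : Set B | Sph M T})
    (sph_pair s t h)
  have hT : Sph M T := hmax.1
  have := par_finite cs heven hT
  obtain ⟨T', hT', g, hg⟩ := tits cs' heven' (par cs T)
  have := par_finite cs' heven' hT'
  obtain ⟨T2, hT2, k, hk⟩ := tits cs heven (par cs' T')
  have hsub : T ⊆ T2 := by
    classical
    intro u hu
    have h1 := hk _ (hg _ (simple_mem_par cs hu))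
    refine vec_par cs heven h1 u ?_
    rw [vec_conj, vec_conj, vec_simple]
    simp
  have heq : T2 = T := Set.Subset.antisymm (hmax.2 hT2 hsub) hsub
  subst heq
  exact ⟨T2, T', ⟨hT, hT', ⟨g, hg⟩, ⟨k, hk⟩⟩, hle (by simp), hle (by simp)⟩

lemma par_map (e : W ≃* W) (cs : CoxeterSystem M W) (T : Set B) :
    par (cs.map e) T = (par cs T).map (e : W →* W) := by
  unfold par
  rw [MonoidHom.map_closure, Set.image_image]
  congr 1

include heven heven' in
lemma F5 [Finite B] [Finite B'] (cs : CoxeterSystem M W) (cs' : CoxeterSystem M' W)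
    {s t : B} (hb : Big M s t) : ∃ a b, Ep cs cs' s t a b := by
  obtain ⟨T, T', hTp, hs, ht⟩ := F6 heven heven' cs cs' hb.2.1
  obtain ⟨hT, hT', ⟨g, hg⟩, ⟨k, hk⟩⟩ := hTp
  have f1 := par_finite cs heven hT
  have f2 := par_finite cs' heven' hT'
  let cs2 := cs'.map (MulAut.conj g⁻¹)
  have f3 := par_finite cs2 heven' hT'
  have hsimp : ∀ u, cs2.simple u = g⁻¹ * cs'.simple u * g := by
    intro u; simp [cs2]
  have hcc : ∀ a b, cc cs2 a b = g⁻¹ * cc cs' a b * g := by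
    intro a b
    unfold cc
    rw [hsimp, hsimp]
    simp only [pow_two]
    group
  have hW : par cs T = par cs2 T' := by
    have hle : par cs T ≤ par cs2 T' := by
      intro x hx
      rw [par_map]
      refine ⟨_, hg x hx, ?_⟩
      simp [MulAut.conj_apply, mul_assoc]
    refine Subgroup.eq_of_le_of_card_ge hle ?_
    have e1 : Nat.card (par cs2 T') = Nat.card (par cs' T') := by
      rw [par_map]
      exact Subgroup.card_map_of_injective (MulEquiv.injective _)
    rw [e1]
    refine Nat.card_le_card_of_injective (fun x => (⟨k * x * k⁻¹, hk x x.2⟩ : par cs T)) ?_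
    intro x y hxy
    have : k * (x : W) * k⁻¹ = k * y * k⁻¹ := congrArg Subtype.val hxy
    exact Subtype.ext (by simpa using this)
  obtain ⟨a, ha, b, hb', hab, n, hn⟩ := core cs cs2 heven heven' hT hT' hW s t hs ht hb
  obtain ⟨u, hu, w, hw, huw, l, hl⟩ := core cs2 cs heven' heven hT' hT hW.symm a b ha hb' hab
  have hst : cc cs s t ∈ par cs ({s, t} : Set B) := cc_mem cs (by simp) (by simp)
  have hN := lemN cs heven u w huw {s, t} 1 (by
    change 1 * cc cs u w * 1⁻¹ ∈ _
    rw [one_mul, inv_one, mul_one, hl, hn]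
    exact zpow_mem (zpow_mem hst _) _)
  have hl2 : ∃ l : ℤ, cc cs s t = cc cs2 a b ^ l := by
    have hne := huw.1
    simp only [Set.mem_insert_iff, Set.mem_singleton_iff] at hN
    rcases hN with ⟨rfl | rfl, rfl | rfl⟩
    · exact absurd rfl hne
    · exact ⟨l, hl⟩
    · refine ⟨-l, ?_⟩
      rw [cc_swap, hl, zpow_neg]
    · exact absurd rfl hne
  obtain ⟨l2, hl2⟩ := hl2
  refine ⟨a, b, hb, hab, ⟨g, n, ?_⟩, ⟨g⁻¹, l2, ?_⟩⟩
  · rw [← hn, hcc]; group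
  · rw [hl2, hcc]
    have := conj_zpow (a := g⁻¹) (b := cc cs' a b) (i := l2)
    rw [inv_inv] at this ⊢
    exact this

end Facts

end EvenCox



namespace EvenCox

open Classical in
lemma key_count {ι X : Type*} [Fintype ι] [Fintype X] (f : X → Set ι) (J : Set ι) :
      (Finset.univ.filter fun s => J ⊆ f s).card = (Finset.univ.filter fun s => f s = J).card +
      ∑ K ∈ Finset.univ.filter (fun K => J ⊂ K), (Finset.univ.filter fun s => f s = K).card := by
  have h1 : (Finset.univ.filter fun s => J ⊆ f s) = (Finset.univ.filter fun s => f s = J) ∪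
      (Finset.univ.filter fun s => J ⊂ f s) := by
    ext s
    simp only [Finset.mem_filter, Finset.mem_univ, true_and, Finset.mem_union]
    rw [Set.ssubset_iff_subset_ne]
    constructor
    · intro hs
      by_cases he : f s = J
      · exact Or.inl he
      · exact Or.inr ⟨hs, Ne.symm he⟩
    · rintro (hs | hs)
      · exact hs ▸ subset_rfl
      · exact hs.1
  rw [h1, Finset.card_union_of_disjoint]
  · congr 1
    rw [Finset.card_eq_sum_card_fiberwise (f := f) (t := Finset.univ.filter (fun K => J ⊂ K))]
    · refine Finset.sum_congr rfl fun K hK => ?_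
      congr 1
      ext s
      simp only [Finset.mem_filter, Finset.mem_univ, true_and] at hK ⊢
      constructor
      · exact fun hs => hs.2
      · rintro rfl; exact ⟨hK, rfl⟩
    · intro s hs
      simpa using hs
  · rw [Finset.disjoint_filter]
    intro s _ hs h2
    rw [hs] at h2
    exact ssubset_irrefl _ h2

lemma counting {ι S S' : Type*} [Finite ι] [Finite S] [Finite S'] (A : ι → Set S) (A' : ι → Set S')
    (h : ∀ J : Set ι, {s | ∀ j ∈ J, s ∈ A j}.ncard = {s | ∀ j ∈ J, s ∈ A' j}.ncard) :
    ∃ ψ : S ≃ S', ∀ s j, s ∈ A j ↔ ψ s ∈ A' j := by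
  classical
  have := Fintype.ofFinite ι
  have := Fintype.ofFinite S
  have := Fintype.ofFinite S'
  let τ : S → Set ι := fun s => {j | s ∈ A j}
  let τ' : S' → Set ι := fun s => {j | s ∈ A' j}
  have hJ : ∀ J : Set ι, (Finset.univ.filter fun s => J ⊆ τ s).card =
      (Finset.univ.filter fun s => J ⊆ τ' s).card := by
    intro J
    have := h J
    rw [Set.ncard_eq_toFinset_card', Set.ncard_eq_toFinset_card'] at this
    convert this using 2 <;> (ext s; simp only [Set.mem_toFinset, Set.mem_setOf_eq]; exact Finset.mem_filter.trans (and_iff_right (Finset.mem_univ _)))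
  have fib : ∀ J : Set ι, (Finset.univ.filter fun s => τ s = J).card =
      (Finset.univ.filter fun s => τ' s = J).card := by
    intro J
    induction J using WellFoundedGT.induction with
    | ind J ih =>
    have e1 := hJ J
    rw [key_count τ J, key_count τ' J] at e1
    have e2 : ∑ K ∈ Finset.univ.filter (fun K => J ⊂ K), (Finset.univ.filter fun s => τ s = K).card
      = ∑ K ∈ Finset.univ.filter (fun K => J ⊂ K), (Finset.univ.filter fun s => τ' s = K).card := by
      refine Finset.sum_congr rfl fun K hK => ih K ?_
      simpa using hK
    omega
  have eqv : ∀ J : Set ι, Nonempty ({s // τ s = J} ≃ {s // τ' s = J}) := by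
    intro J
    rw [← Fintype.card_eq, Fintype.card_subtype, Fintype.card_subtype]
    exact fib J
  let e : ∀ J : Set ι, {s // τ s = J} ≃ {s // τ' s = J} := fun J => (eqv J).some
  refine ⟨Equiv.ofFiberEquiv e, fun s j => ?_⟩
  have := Equiv.ofFiberEquiv_map e s
  have h2 : j ∈ τ' (Equiv.ofFiberEquiv e s) ↔ j ∈ τ s := by rw [this]
  exact h2.symm

section Comb

variable {B B' W : Type*} [Group W] {M : CoxeterMatrix B} {M' : CoxeterMatrix B'}
  (cs : CoxeterSystem M W) (cs' : CoxeterSystem M' W)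
  (heven : ∀ i j : B, i ≠ j → Even (M i j)) (heven' : ∀ i j : B', i ≠ j → Even (M' i j))

lemma fac [Fintype B] (x : W) :
    ∑ i, vec cs heven x i • vec cs' heven' (cs.simple i) = vec cs' heven' x := by
  classical
  induction x using cs.simple_induction with
  | simple u => simp [vec_simple, Pi.single_apply]
  | one => simp [vec_one]
  | mul x y hx hy =>
    rw [vec_mul cs' heven' x y, ← hx, ← hy, ← Finset.sum_add_distrib]
    refine Finset.sum_congr rfl fun i _ => ?_
    rw [vec_mul, Pi.add_apply, add_smul]

include heven' in
lemma ncard_le_of_supp [Finite B] [Finite B'] (X : Set B) (X' : Set B')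
    (h : ∀ a ∈ X', ∀ i, vec cs heven (cs'.simple a) i ≠ 0 → i ∈ X) : X'.ncard ≤ X.ncard := by
  classical
  have := Fintype.ofFinite B
  have := Fintype.ofFinite B'
  have := Fintype.ofFinite X'
  let L : (B → ZMod 2) →ₗ[ZMod 2] (B' → ZMod 2) :=
    ∑ i, (LinearMap.proj i : (B → ZMod 2) →ₗ[ZMod 2] ZMod 2).smulRight (vec cs' heven' (cs.simple i))
  have hL : ∀ x, L (vec cs heven x) = vec cs' heven' x := by
    intro x
    rw [← fac cs cs' heven heven' x]
    simp [L, LinearMap.sum_apply]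
  have hli : LinearIndependent (ZMod 2) (fun a : B' => vec cs heven (cs'.simple a)) := by
    apply LinearIndependent.of_comp L
    have e : (L ∘ fun a : B' => vec cs heven (cs'.simple a)) = Pi.basisFun (ZMod 2) B' := by
      funext a
      simp only [Function.comp_apply]
      rw [hL, vec_simple, Pi.basisFun_apply]
    rw [e]
    exact (Pi.basisFun (ZMod 2) B').linearIndependent
  have hli2 := hli.comp (Subtype.val : X' → B') Subtype.val_injective
  let w : Set (B → ZMod 2) := (fun i : B => (Pi.single i 1 : B → ZMod 2)) '' X
  have := Fintype.ofFinite w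
  have := Fintype.ofFinite X'
  have hsp := linearIndependent_le_span' _ hli2 w (by
    rintro _ ⟨⟨a, ha⟩, rfl⟩
    simp only [Function.comp_apply]
    have e : vec cs heven (cs'.simple a) =
        ∑ i, vec cs heven (cs'.simple a) i • (Pi.single i 1 : B → ZMod 2) := by
      ext k; simp [Finset.sum_apply, Pi.single_apply]
    rw [e]
    refine Submodule.sum_mem _ fun i _ => ?_
    by_cases hi : vec cs heven (cs'.simple a) i = 0
    · rw [hi, zero_smul]; exact zero_mem _
    · exact Submodule.smul_mem _ _ (Submodule.subset_span ⟨i, h a ha i hi, rfl⟩))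
  rw [Cardinal.mk_fintype, Nat.cast_le, ← Nat.card_eq_fintype_card, ← Nat.card_eq_fintype_card] at hsp
  exact hsp.trans (Set.ncard_image_le (Set.toFinite X))

lemma z2 (x y : ZMod 2) (h : x + y = 1) : x ≠ 0 ∨ y ≠ 0 := by
  revert x y; decide

lemma z2b (x y z : ZMod 2) (h : x + y = 1) (hy : y = 0) (h2 : x + z = 0) : z ≠ 0 := by
  revert x y z; decide

variable {cs cs'}

include heven heven' in
lemma keyEdge [Finite B] [Finite B'] {s t s1 t1 : B} {a b b1 : B'} (h0 : Ep cs cs' s t a b)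
    (h1 : Ep cs cs' s1 t1 a b1) (hv : vec cs heven (cs'.simple a) s ≠ 0) : s = s1 ∨ s = t1 := by
  by_contra hcon
  push Not at hcon
  by_cases hbb : b = b1
  · subst hbb
    rcases F4 heven h0.symm h1.symm with h | h
    · exact hcon.1 h.1.symm
    · exact hcon.2 h.2.symm
  obtain ⟨T0, T0', hT0, hs0, ht0⟩ := F6 heven heven' cs cs' h0.1.2.1
  obtain ⟨T1, T1', hT1, hs1, ht1⟩ := F6 heven heven' cs cs' h1.1.2.1
  obtain ⟨ha0, hb0⟩ := F2 heven' h0 hT0 hs0 ht0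
  obtain ⟨ha1, hb1⟩ := F2 heven' h1 hT1 hs1 ht1
  have n1 : b ∉ T1' := fun hb =>
    h0.2.1.2.2 (hT1.2.1.two ha1 hb1 hb h1.2.1 h0.2.1.1.symm hbb).1
  have n0 : b1 ∉ T0' := fun hb =>
    h1.2.1.2.2 (hT0.2.1.two ha0 hb0 hb h0.2.1 h1.2.1.1.symm (Ne.symm hbb)).1
  have hsT1 : s ∈ T1 := F1 heven hT1 ha1 s hv
  have e1 := F3a heven' h0.symm
  have e2 : vec cs' heven' (cs.simple s) b = 0 := by
    by_contra h
    exact n1 (F1 heven' hT1.symm hsT1 b h)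
  obtain ⟨c1, c2⟩ := hT1.1.two hs1 ht1 hsT1 h1.1 hcon.1 hcon.2
  have e3 := F3b heven' h1.symm s c1 c2
  exact n0 (F1 heven' hT0.symm hs0 b1 (z2b _ _ _ e1 e2 e3))

variable (cs cs') in
def EpS (e : Set B) (e' : Set B') : Prop :=
  ∃ s t a b, e = {s, t} ∧ e' = {a, b} ∧ Ep cs cs' s t a b

lemma EpS.symm {e : Set B} {e' : Set B'} (h : EpS cs cs' e e') : EpS cs' cs e' e := by
  obtain ⟨s, t, a, b, h1, h2, h3⟩ := h
  exact ⟨a, b, s, t, h2, h1, h3.symm⟩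

include heven heven' in
lemma ineq [Finite B] [Finite B'] {ι : Type*} (A : ι → Set B) (A' : ι → Set B')
    (hg : ∀ i, Tp cs cs' (A i) (A' i) ∨ EpS cs cs' (A i) (A' i)) :
    {a | ∀ i, a ∈ A' i}.ncard ≤ {s | ∀ i, s ∈ A i}.ncard := by
  by_cases hE : ∃ i, EpS cs cs' (A i) (A' i)
  · obtain ⟨i0, s, t, a, b, hA, hA', he⟩ := hE
    by_cases hab : (∀ i, a ∈ A' i) ∧ (∀ i, b ∈ A' i)
    · have hst : ({s, t} : Set B) ⊆ {s | ∀ i, s ∈ A i} := by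
        have key : ∀ i, s ∈ A i ∧ t ∈ A i := by
          intro i
          rcases hg i with h | ⟨s1, t1, a1, b1, h1, h2, h3⟩
          · exact F2 heven he.symm h.symm (hab.1 i) (hab.2 i)
          · have p1 := hab.1 i
            have p2 := hab.2 i
            rw [h2] at p1 p2
            rw [h1]
            have hn := he.2.1.1
            simp only [Set.mem_insert_iff, Set.mem_singleton_iff] at p1 p2 ⊢
            rcases p1 with rfl | rfl <;> rcases p2 with rfl | rfl
            · exact absurd rfl hn
            · rcases F4 heven he.symm h3.symm with ⟨rfl, rfl⟩ | ⟨rfl, rfl⟩ <;> simp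
            · rcases F4 heven he.symm h3.swap'.symm with ⟨rfl, rfl⟩ | ⟨rfl, rfl⟩ <;> simp
            · exact absurd rfl hn
        rintro u (rfl | rfl) i
        · exact (key i).1
        · exact (key i).2
      have l1 := Set.ncard_le_ncard hst (Set.toFinite _)
      rw [Set.ncard_pair he.1.1] at l1
      have l2 : {a | ∀ i, a ∈ A' i} ⊆ ({a, b} : Set B') := fun c hc => hA' ▸ hc i0
      have l3 := Set.ncard_le_ncard l2 (Set.toFinite _)
      rw [Set.ncard_pair he.2.1.1] at l3
      omega
    · by_cases hemp : {a | ∀ i, a ∈ A' i} = ∅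
      · rw [hemp]; simp
      obtain ⟨c, hc⟩ := Set.nonempty_iff_ne_empty.2 hemp
      have hle : {a | ∀ i, a ∈ A' i}.ncard ≤ 1 := by
        rw [Set.ncard_le_one (Set.toFinite _)]
        intro x hx y hy
        have x1 : x ∈ ({a, b} : Set B') := hA' ▸ hx i0
        have y1 : y ∈ ({a, b} : Set B') := hA' ▸ hy i0
        simp only [Set.mem_insert_iff, Set.mem_singleton_iff] at x1 y1
        rcases x1 with rfl | rfl <;> rcases y1 with rfl | rfl
        · rfl
        · exact absurd ⟨hx, hy⟩ hab
        · exact absurd ⟨hy, hx⟩ hab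
        · rfl
      have claim : ∀ (s t : B) (b : B'), Ep cs cs' s t c b →
          vec cs heven (cs'.simple c) s ≠ 0 → ∀ i, s ∈ A i := by
        intro s t b he hv i
        rcases hg i with h | ⟨s1, t1, a1, b1, h1, h2, h3⟩
        · exact F1 heven h (hc i) s hv
        · have p1 := hc i
          rw [h2] at p1
          rw [h1]
          simp only [Set.mem_insert_iff, Set.mem_singleton_iff] at p1 ⊢
          rcases p1 with rfl | rfl
          · exact keyEdge heven heven' he h3 hv
          · exact keyEdge heven heven' he h3.swap' hv
      have hex : ∃ d, Ep cs cs' s t c d := by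
        have p1 := hc i0
        rw [hA'] at p1
        rcases p1 with rfl | p1
        · exact ⟨b, he⟩
        · rw [Set.mem_singleton_iff] at p1
          subst p1
          exact ⟨a, he.swap'⟩
      obtain ⟨d, hd⟩ := hex
      have hne : {s | ∀ i, s ∈ A i}.Nonempty := by
        rcases z2 _ _ (F3a heven hd) with h | h
        · exact ⟨s, claim s t d hd h⟩
        · exact ⟨t, claim t s d hd.swap h⟩
      have := (Set.ncard_pos (Set.toFinite _)).2 hne
      omega
  · have hTp : ∀ i, Tp cs cs' (A i) (A' i) := fun i =>
      (hg i).resolve_right fun h => hE ⟨i, h⟩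
    apply ncard_le_of_supp cs cs' heven heven'
    intro a ha i hi j
    exact F1 heven (hTp j) (ha j) i hi

end Comb

end EvenCox

open EvenCox in
theorem even_coxeterSystems_isomorphic {B B' W : Type*} [Group W] [Finite B] [Finite B']
    {M : CoxeterMatrix B} {M' : CoxeterMatrix B'}
    (cs : CoxeterSystem M W) (cs' : CoxeterSystem M' W)
    (h : ∀ i j : B, i ≠ j → Even (M i j))
    (h' : ∀ i' j' : B', i' ≠ j' → Even (M' i' j')) :
    ∃ ψ : B ≃ B', ∀ i j : B, M i j = M' (ψ i) (ψ j) := by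
  let ι := {p : Set B × Set B' // Tp cs cs' p.1 p.2 ∨ EpS cs cs' p.1 p.2}
  obtain ⟨ψ, hψ⟩ := counting (ι := ι) (fun p => p.1.1) (fun p => p.1.2) (by
    intro J
    have e1 := ineq (cs := cs) (cs' := cs') h h' (ι := J) (fun p => p.1.1.1) (fun p => p.1.1.2)
      (fun p => p.1.2)
    have e2 := ineq (cs := cs') (cs' := cs) h' h (ι := J) (fun p => p.1.1.2) (fun p => p.1.1.1)
      (fun p => p.1.2.imp Tp.symm EpS.symm)
    simp only [Subtype.forall] at e1 e2 ⊢
    exact le_antisymm (by simpa using e2) (by simpa using e1))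
  have hT : ∀ T T', Tp cs cs' T T' → ∀ s, s ∈ T ↔ ψ s ∈ T' := fun T T' hp s =>
    hψ s ⟨(T, T'), Or.inl hp⟩
  have hE : ∀ e e', EpS cs cs' e e' → ∀ s, s ∈ e ↔ ψ s ∈ e' := fun T T' hp s =>
    hψ s ⟨(T, T'), Or.inr hp⟩
  refine ⟨ψ, fun s t => ?_⟩
  by_cases hst : s = t
  · subst hst; simp
  have hst' : ψ s ≠ ψ t := fun e => hst (ψ.injective e)
  have z1 : M s t ≠ 0 → M' (ψ s) (ψ t) ≠ 0 := by
    intro hz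
    obtain ⟨T, T', hp, hs, ht⟩ := F6 h h' cs cs' hz
    exact hp.2.1.1 _ ((hT T T' hp s).1 hs) _ ((hT T T' hp t).1 ht)
  have z2 : M' (ψ s) (ψ t) ≠ 0 → M s t ≠ 0 := by
    intro hz
    obtain ⟨T', T, hp, hs, ht⟩ := F6 h' h cs' cs hz
    exact hp.2.1.1 _ ((hT T T' hp.symm s).2 hs) _ ((hT T T' hp.symm t).2 ht)
  have fin : ∀ s t : B, ∀ a b : B', Ep cs cs' s t a b → s ∈ ({s, t} : Set B) →
      (a = ψ s ∧ b = ψ t) ∨ (a = ψ t ∧ b = ψ s) → M s t = M' (ψ s) (ψ t) := by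
    intro s t a b he _ hh
    rw [F4label h h' he]
    rcases hh with ⟨rfl, rfl⟩ | ⟨rfl, rfl⟩
    · rfl
    · exact M'.symmetric _ _
  by_cases b1 : Big M s t
  · obtain ⟨a, b, he⟩ := F5 h h' cs cs' b1
    have hS : EpS cs cs' {s, t} {a, b} := ⟨s, t, a, b, rfl, rfl, he⟩
    have m1 := (hE _ _ hS s).1 (by simp)
    have m2 := (hE _ _ hS t).1 (by simp)
    simp only [Set.mem_insert_iff, Set.mem_singleton_iff] at m1 m2
    refine fin s t a b he (by simp) ?_
    rcases m1 with m1 | m1 <;> rcases m2 with m2 | m2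
    · exact absurd (m1.trans m2.symm) hst'
    · exact Or.inl ⟨m1.symm, m2.symm⟩
    · exact Or.inr ⟨m2.symm, m1.symm⟩
    · exact absurd (m1.trans m2.symm) hst'
  by_cases b2 : Big M' (ψ s) (ψ t)
  · exfalso
    obtain ⟨u, w, he⟩ := F5 h' h cs' cs b2
    have hS : EpS cs cs' {u, w} {ψ s, ψ t} := ⟨u, w, _, _, rfl, rfl, he.symm⟩
    have m1 := (hE _ _ hS s).2 (by simp)
    have m2 := (hE _ _ hS t).2 (by simp)
    simp only [Set.mem_insert_iff, Set.mem_singleton_iff] at m1 m2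
    have hb := he.2.1
    rcases m1 with rfl | rfl <;> rcases m2 with rfl | rfl
    · exact hst rfl
    · exact b1 hb
    · exact b1 hb.symm
    · exact hst rfl
  unfold Big at b1 b2
  by_cases hz : M s t = 0
  · have : M' (ψ s) (ψ t) = 0 := by by_contra hne; exact z2 hne hz
    rw [hz, this]
  · have h1 := z1 hz
    have h2 : M s t = 2 := by tauto
    have h3 : M' (ψ s) (ψ t) = 2 := by tauto
    rw [h2, h3]
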